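/- For every integer p ≥ 3 and every real λ with 0 < λ < λ*, there exists N ∈ ℕ such that k_p(λ) = min{ |G^±| / mult(λ, G^±) : G^± a signed graph with at most N vertices, χ(G^±) ≤ p and λ^1(G^±) = λ } (where the minimum over an empty set is ∞); in particular, if k_p(λ) < ∞ then the infimum defining k_p(λ) is attained by some signed graph. -/

import Mathlib

open Classical ENNReal

def IsEigenvalue {V : Type*} [Fintype V] (A : Matrix V V ℝ) (μ : ℝ) : Prop :=
  ∃ v : V → ℝ, v ≠ 0 ∧ A.mulVec v = μ • v

noncomputable def maxEig {V : Type*} [Fintype V] (A : Matrix V V ℝ) : ℝ :=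
  sSup {μ : ℝ | IsEigenvalue A μ}

noncomputable def eigMult {n : ℕ} (A : Matrix (Fin n) (Fin n) ℝ) (μ : ℝ) : ℕ :=
  Module.finrank ℝ (Module.End.eigenspace (Matrix.toLin' A) μ)

structure SignedGraph (n : ℕ) where
  mat : Matrix (Fin n) (Fin n) ℝ
  isSymm : mat.IsSymm
  diag_zero : ∀ i, mat i i = 0
  entries : ∀ i j, mat i j = -1 ∨ mat i j = 0 ∨ mat i j = 1

def ChromLe {n : ℕ} (G : SignedGraph n) (p : ℕ) : Prop :=
  ∃ c : Fin n → Fin p, ∀ i j, (G.mat i j = 1 → c i = c j) ∧ (G.mat i j = -1 → c i ≠ c j)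

noncomputable def kp (p : ℕ) (lam : ℝ) : ℝ≥0∞ :=
  ⨅ (n : ℕ) (G : SignedGraph n) (_ : ChromLe G p ∧ maxEig G.mat = lam),
    (n : ℝ≥0∞) / (eigMult G.mat lam : ℝ≥0∞)

section Kernel

variable {N E : Type} [Fintype N] [Fintype E]

/-- The vector `e_a - e_b`. -/
noncomputable def edgeVec {N : Type} (a b : N) : N → ℝ :=
  fun i => (if i = a then 1 else 0) - (if i = b then 1 else 0)

theorem edgeVec_dotProduct (a b : N) (W : N → ℝ) : edgeVec a b ⬝ᵥ W = W a - W b := by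
  simp [edgeVec, dotProduct, sub_mul, Finset.sum_sub_distrib]

theorem edgeVec_sum {N : Type} (a b : N) (S : Finset N) :
    ∑ i ∈ S, edgeVec a b i = (if a ∈ S then 1 else 0) - (if b ∈ S then 1 else 0) := by
  simp [edgeVec, Finset.sum_sub_distrib]

/-- The resolvent kernel `ε (L + ε)⁻¹` of the Laplacian `L` of the multigraph with edges
`a e, b e`, given by the properties used of it. -/
structure IsResolvent (a b : E → N) (ε : ℝ) (K : Matrix N N ℝ) : Prop where
  symm : K.transpose = K
  row : ∀ i, ∑ j, K i j = 1
  nonneg : ∀ i j, 0 ≤ K i j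
  eqn : ∀ w i, ∑ e, edgeVec (a e) (b e) i * ((K.mulVec w) (a e) - (K.mulVec w) (b e))
    + ε * (K.mulVec w) i = ε * w i

theorem exists_isResolvent (a b : E → N) {ε : ℝ} (hε : 0 < ε) :
    ∃ K : Matrix N N ℝ, IsResolvent a b ε K := by
  set B : Matrix N E ℝ := Matrix.of fun i e => edgeVec (a e) (b e) i with hB
  set T : Matrix N N ℝ := B * B.transpose + ε • 1 with hT
  have hTpd : T.PosDef := by
    have h1 : (B * B.transpose).PosSemidef := by
      simpa using Matrix.posSemidef_self_mul_conjTranspose B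
    have h2 : (ε • (1 : Matrix N N ℝ)).PosDef := Matrix.PosDef.one.smul hε
    exact Matrix.PosDef.posSemidef_add h1 h2
  have hTu : IsUnit T := hTpd.isUnit
  have hTd : IsUnit T.det := (Matrix.isUnit_iff_isUnit_det T).1 hTu
  have hTs : T.transpose = T := by
    simp [hT, Matrix.transpose_mul]
  have hTapp : ∀ f i, (T.mulVec f) i
      = ∑ e, edgeVec (a e) (b e) i * (f (a e) - f (b e)) + ε * f i := by
    intro f i
    have : ∀ e, (B.transpose.mulVec f) e = f (a e) - f (b e) := by
      intro e
      rw [← edgeVec_dotProduct (a e) (b e) f]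
      rfl
    simp only [hT, Matrix.add_mulVec, ← Matrix.mulVec_mulVec, Pi.add_apply, Matrix.smul_mulVec,
      Matrix.one_mulVec, Pi.smul_apply, smul_eq_mul]
    congr 1
    simp only [Matrix.mulVec, dotProduct] at this ⊢
    refine Finset.sum_congr rfl fun e _ => ?_
    rw [this]
    rfl
  have hinv : ∀ w, T.mulVec ((ε • T⁻¹).mulVec w) = ε • w := by
    intro w
    rw [Matrix.mulVec_mulVec, Matrix.mul_smul, Matrix.mul_nonsing_inv _ hTd,
      Matrix.smul_mulVec, Matrix.one_mulVec]
  have heqn : ∀ w i, ∑ e, edgeVec (a e) (b e) i *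
      (((ε • T⁻¹).mulVec w) (a e) - ((ε • T⁻¹).mulVec w) (b e))
      + ε * ((ε • T⁻¹).mulVec w) i = ε * w i := by
    intro w i
    rw [← hTapp, hinv]
    rfl
  refine ⟨ε • T⁻¹, ?_, ?_, ?_, heqn⟩
  · rw [Matrix.transpose_smul, Matrix.transpose_nonsing_inv, hTs]
  · have h1 : T.mulVec (fun _ => 1) = ε • (fun _ => (1 : ℝ)) := by
      ext i
      rw [hTapp]
      simp
    have h2 : (ε • T⁻¹).mulVec (fun _ => (1 : ℝ)) = fun _ => 1 := by
      rw [Matrix.smul_mulVec, ← Matrix.mulVec_smul, ← h1, Matrix.mulVec_mulVec,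
        Matrix.nonsing_inv_mul _ hTd, Matrix.one_mulVec]
    intro i
    have := congrFun h2 i
    simpa [Matrix.mulVec, dotProduct] using this
  · intro i j
    set f : N → ℝ := (ε • T⁻¹).mulVec (Pi.single j 1) with hf
    have hfi : ∀ i, f i = (ε • T⁻¹) i j := by
      intro i
      simp [hf]
    rw [← hfi]
    have : Nonempty N := ⟨i⟩
    obtain ⟨k, hk⟩ := Finite.exists_min f
    refine le_trans ?_ (hk i)
    have h := heqn (Pi.single j 1) k
    rw [← hf] at h
    have h1 : ∑ e, edgeVec (a e) (b e) k * (f (a e) - f (b e)) ≤ 0 := by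
      refine Finset.sum_nonpos fun e _ => ?_
      have ha := hk (a e)
      have hb := hk (b e)
      unfold edgeVec
      split_ifs with h1 h2 h2
      · simp
      · subst h1; linarith
      · subst h2; linarith
      · simp
    have h2 : 0 ≤ ε * (Pi.single j 1 : N → ℝ) k := by
      refine mul_nonneg hε.le ?_
      by_cases hjk : k = j
      · subst hjk; simp
      · simp [hjk]
    have h3 : 0 ≤ ε * f k := by linarith
    exact (mul_nonneg_iff_of_pos_left hε).1 h3

/-- The Dirichlet form of a kernel. -/
noncomputable def dirForm (K : Matrix N N ℝ) (w : N → ℝ) : ℝ :=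
  w ⬝ᵥ w - w ⬝ᵥ K.mulVec w

/-- The indicator vector of a finite set. -/
noncomputable def indVec {N : Type} (U : Finset N) : N → ℝ := fun i => if i ∈ U then 1 else 0

theorem IsResolvent.dirForm_eq {a b : E → N} {ε : ℝ} {K : Matrix N N ℝ}
    (hK : IsResolvent a b ε K) (w : N → ℝ) :
    dirForm K w = 1 / 2 * ∑ i, ∑ j, K i j * (w i - w j) ^ 2 := by
  have hcol : ∀ j, ∑ i, K i j = 1 := by
    intro j
    rw [← hK.row j]
    exact Finset.sum_congr rfl fun i _ => by
      conv_lhs => rw [← hK.symm]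
      rfl
  have h1 : ∑ i, ∑ j, K i j * (w i - w j) ^ 2
      = ∑ i, ∑ j, K i j * w i ^ 2 + ∑ i, ∑ j, K i j * w j ^ 2
        - 2 * ∑ i, ∑ j, K i j * (w i * w j) := by
    simp only [Finset.mul_sum, ← Finset.sum_add_distrib, ← Finset.sum_sub_distrib]
    refine Finset.sum_congr rfl fun i _ => Finset.sum_congr rfl fun j _ => ?_
    ring
  have h2 : ∑ i, ∑ j, K i j * w i ^ 2 = w ⬝ᵥ w := by
    simp only [← Finset.sum_mul, hK.row, one_mul, dotProduct, sq]
  have h3 : ∑ i, ∑ j, K i j * w j ^ 2 = w ⬝ᵥ w := by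
    rw [Finset.sum_comm]
    simp only [← Finset.sum_mul, hcol, one_mul, dotProduct, sq]
  have h4 : ∑ i, ∑ j, K i j * (w i * w j) = w ⬝ᵥ K.mulVec w := by
    simp only [dotProduct, Matrix.mulVec, Finset.mul_sum]
    refine Finset.sum_congr rfl fun i _ => Finset.sum_congr rfl fun j _ => ?_
    ring
  rw [h1, h2, h3, h4, dirForm]
  ring

end Kernel

section Green

/-- The continued fraction `1 / (μ - 1 / (μ - ⋯))` of depth `j`. -/
noncomputable def contFrac (μ : ℝ) : ℕ → ℝ
  | 0 => 0
  | j + 1 => 1 / (μ - contFrac μ j)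

theorem contFrac_bounds {t μ : ℝ} (ht : 1 < t) (hμ : μ = t + 1 / t) (j : ℕ) :
    contFrac μ j ≤ 1 / t ∧ 1 / t - contFrac μ j ≤ (1 / t ^ 2) ^ j := by
  have ht0 : 0 < t := by linarith
  induction j with
  | zero =>
    simp only [contFrac, pow_zero, sub_zero]
    refine ⟨by positivity, ?_⟩
    rw [div_le_one ht0]; exact ht.le
  | succ j ih =>
    obtain ⟨h1, h2⟩ := ih
    set r := contFrac μ j
    have hd : t ≤ μ - r := by rw [hμ]; linarith
    have hd0 : 0 < μ - r := by linarith
    have e1 : contFrac μ (j + 1) = 1 / (μ - r) := rfl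
    have e2 : 1 / t - 1 / (μ - r) = (1 / t - r) / (t * (μ - r)) := by
      rw [div_sub_div _ _ ht0.ne' hd0.ne']
      congr 1
      rw [hμ]; ring
    constructor
    · rw [e1]
      exact one_div_le_one_div_of_le ht0 hd
    · rw [e1, e2, pow_succ, ← div_eq_mul_one_div]
      rw [div_le_div_iff₀ (by positivity) (by positivity)]
      have h3 : t ^ 2 ≤ t * (μ - r) := by nlinarith
      have h4 : 0 ≤ 1 / t - r := by linarith
      have h5 : 0 ≤ (1 / t ^ 2) ^ j := by positivity
      calc (1 / t - r) * t ^ 2 ≤ (1 / t - r) * (t * (μ - r)) := by gcongr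
        _ ≤ _ := by gcongr

theorem contFrac_mul_le {μ : ℝ} (hμ : ∀ j, contFrac μ j < μ) {g : ℕ → ℝ} (hg : ∀ i, 0 ≤ g i)
    (s : ℕ) (r : ℕ)
    (h : ∀ i, s < i → i ≤ s + r → g (i - 1) + g (i + 1) ≤ μ * g i) :
    contFrac μ r * g (s + r + 1) ≤ g (s + r) := by
  induction r with
  | zero => simpa [contFrac] using hg s
  | succ r ih =>
    have ih' := ih fun i h1 h2 => h i h1 (by omega)
    have h1 := h (s + r + 1) (by omega) (by omega)
    have e : s + r + 1 - 1 = s + r := by omega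
    rw [e] at h1
    have hd : 0 < μ - contFrac μ r := by linarith [hμ r]
    have e2 : contFrac μ (r + 1) = 1 / (μ - contFrac μ r) := rfl
    rw [e2, one_div, inv_mul_le_iff₀ hd]
    have e3 : s + (r + 1) + 1 = s + r + 1 + 1 := by omega
    have e4 : s + (r + 1) = s + r + 1 := by omega
    rw [e3, e4]
    linarith

/-- A nonnegative supersolution of `(-Δ + ε) g = δ_k` on the interval `[0, n]` is bounded below
at `k` by the Green function of a subinterval `[k - j - 1, k + j' + 1]`. -/
theorem one_le_mul_of_supersolution {μ : ℝ} (hμ : ∀ j, contFrac μ j < μ) {g : ℕ → ℝ}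
    (hg : ∀ i, 0 ≤ g i) {n k j j' : ℕ} (hj : j + 1 ≤ k) (hj' : k + j' + 1 ≤ n)
    (h : ∀ i, 1 ≤ i → i < n → g (i - 1) + g (i + 1) + (if i = k then 1 else 0) ≤ μ * g i) :
    1 ≤ g k * (μ - contFrac μ j - contFrac μ j') := by
  have hL := contFrac_mul_le hμ hg (k - j - 1) j (fun i h1 h2 => by
    have := h i (by omega) (by omega)
    rw [if_neg (by omega)] at this
    linarith)
  have hR := contFrac_mul_le hμ (g := fun i => g (n - i)) (fun i => hg _) (n - (k + j' + 1)) j'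
    (fun i h1 h2 => by
      have := h (n - i) (by omega) (by omega)
      rw [if_neg (by omega)] at this
      have e1 : n - (i - 1) = n - i + 1 := by omega
      have e2 : n - (i + 1) = n - i - 1 := by omega
      simp only [e1, e2]
      linarith)
  have e1 : k - j - 1 + j + 1 = k := by omega
  have e2 : k - j - 1 + j = k - 1 := by omega
  have e3 : n - (n - (k + j' + 1) + j' + 1) = k := by omega
  have e4 : n - (n - (k + j' + 1) + j') = k + 1 := by omega
  rw [e1, e2] at hL
  simp only [e3, e4] at hR
  have := h k (by omega) (by omega)
  rw [if_pos rfl] at this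
  linarith

end Green

section Cut

variable {N E : Type} [Fintype N] [Fintype E]

/-- Every cut of the multigraph with edges `a e, b e` is crossed by an edge. -/
def CutConnected {N E : Type} (a b : E → N) : Prop :=
  ∀ U : Finset N, U.Nonempty → (∃ x, x ∉ U) →
    ∃ e, (a e ∈ U ∧ b e ∉ U) ∨ (a e ∉ U ∧ b e ∈ U)

theorem exists_antitone_enumeration (f : N → ℝ) :
    ∃ σ : Fin (Fintype.card N) ≃ N, Antitone (f ∘ σ) := by
  set e0 := (Fintype.equivFin N).symm
  refine ⟨(Tuple.sort (fun i => -f (e0 i))).trans e0, ?_⟩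
  have := Tuple.monotone_sort (fun i => -f (e0 i))
  intro i j hij
  have h := this hij
  simp only [Function.comp] at h ⊢
  simp only [Equiv.trans_apply]
  linarith

theorem one_le_dirForm_indVec_mul {a b : E → N} {ε μ : ℝ} (hε : 0 < ε) (hμε : μ = 2 + ε)
    {K : Matrix N N ℝ} (hK : IsResolvent a b ε K) (hc : CutConnected a b)
    (hμ : ∀ j, contFrac μ j < μ) (U : Finset N) {j j' : ℕ} (hj : j + 1 ≤ U.card)
    (hj' : U.card + j' + 1 ≤ Fintype.card N) :
    1 ≤ dirForm K (indVec U) * (μ - contFrac μ j - contFrac μ j') := by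
  set n := Fintype.card N with hn
  set k := U.card with hk
  set f : N → ℝ := K.mulVec (indVec U) with hf
  have hf0 : ∀ i, 0 ≤ f i := by
    intro i
    refine Finset.sum_nonneg fun x _ => mul_nonneg (hK.nonneg _ _) ?_
    unfold indVec; split_ifs <;> norm_num
  have hf1 : ∀ i, f i ≤ 1 := by
    intro i
    rw [← hK.row i]
    refine Finset.sum_le_sum fun x _ => ?_
    have := hK.nonneg i x
    unfold indVec; split_ifs <;> simp [this]
  have hcol : ∀ j, ∑ i, K i j = 1 := by
    intro j
    rw [← hK.row j]
    exact Finset.sum_congr rfl fun i _ => by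
      conv_lhs => rw [← hK.symm]
      rfl
  have hfs : ∑ i, f i = k := by
    simp only [hf, Matrix.mulVec, dotProduct]
    rw [Finset.sum_comm]
    simp only [← Finset.sum_mul, hcol, one_mul]
    simp [indVec, hk]
  obtain ⟨σ, hσ⟩ := exists_antitone_enumeration f
  set V : ℕ → Finset N := fun m => Finset.univ.filter fun x => ((σ.symm x : Fin n) : ℕ) < m with hV
  have hmem : ∀ m x, x ∈ V m ↔ ((σ.symm x : Fin n) : ℕ) < m := by simp [hV]
  have hVs : ∀ m (h : m < n), V (m + 1) = insert (σ ⟨m, h⟩) (V m) := by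
    intro m h
    ext x
    simp only [Finset.mem_insert, hmem]
    rw [Nat.lt_succ_iff_lt_or_eq, or_comm]
    refine or_congr_left ?_
    rw [← Equiv.symm_apply_eq, Fin.ext_iff]
  have hVn : ∀ m (h : m < n), σ ⟨m, h⟩ ∉ V m := by
    intro m h
    simp [hmem]
  have hVc : ∀ m, m ≤ n → (V m).card = m := by
    intro m
    induction m with
    | zero => intro _; rw [Finset.card_eq_zero]; ext x; simp [hmem]
    | succ m ih =>
      intro h
      rw [hVs m (by omega), Finset.card_insert_of_notMem (hVn m (by omega)), ih (by omega)]
  set s : ℕ → ℝ := fun m => ∑ x ∈ V m, f x with hs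
  have hss : ∀ m (h : m < n), s (m + 1) = s m + f (σ ⟨m, h⟩) := by
    intro m h
    simp only [hs]
    rw [hVs m h, Finset.sum_insert (hVn m h), add_comm]
  have hsk : ∀ m, s m ≤ k := by
    intro m
    rw [← hfs]
    exact Finset.sum_le_univ_sum_of_nonneg hf0
  have hsm : ∀ m, s m ≤ m := by
    intro m
    rcases le_or_gt m n with h | h
    · calc s m ≤ ∑ x ∈ V m, (1 : ℝ) := Finset.sum_le_sum fun x _ => hf1 x
        _ = m := by simp [hVc m h]
    · refine (hsk m).trans ?_
      have : k ≤ m := by omega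
      exact_mod_cast this
  set g : ℕ → ℝ := fun m => ((min m k : ℕ) : ℝ) - s m with hg
  have hg0 : ∀ m, 0 ≤ g m := by
    intro m
    simp only [hg, Nat.cast_min, sub_nonneg, le_min_iff]
    exact ⟨hsm m, hsk m⟩
  have hcross : ∀ m (h1 : 1 ≤ m) (h2 : m < n),
      f (σ ⟨m - 1, by omega⟩) - f (σ ⟨m, h2⟩) ≤ ε * g m := by
    intro m h1 h2
    set p := f (σ ⟨m - 1, by omega⟩)
    set q := f (σ ⟨m, h2⟩)
    have hin : ∀ x, x ∈ V m → p ≤ f x := by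
      intro x hx
      rw [hmem] at hx
      have := hσ (show σ.symm x ≤ ⟨m - 1, by omega⟩ by
        rw [Fin.le_def]; show ((σ.symm x : Fin n) : ℕ) ≤ m - 1; omega)
      simpa using this
    have hout : ∀ x, x ∉ V m → f x ≤ q := by
      intro x hx
      rw [hmem] at hx
      have := hσ (show (⟨m, h2⟩ : Fin n) ≤ σ.symm x by
        rw [Fin.le_def]; show m ≤ ((σ.symm x : Fin n) : ℕ); omega)
      simpa using this
    have hpq : q ≤ p := by
      have := hσ (show (⟨m - 1, by omega⟩ : Fin n) ≤ ⟨m, h2⟩ by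
        rw [Fin.le_def]; show m - 1 ≤ m; omega)
      simpa using this
    have hsum : ∑ i ∈ V m, (∑ e, edgeVec (a e) (b e) i * (f (a e) - f (b e)) + ε * f i)
        = ∑ i ∈ V m, ε * indVec U i :=
      Finset.sum_congr rfl fun i _ => hK.eqn (indVec U) i
    rw [Finset.sum_add_distrib, Finset.sum_comm, ← Finset.mul_sum, ← Finset.mul_sum] at hsum
    simp only [← Finset.sum_mul, edgeVec_sum] at hsum
    have hnn : ∀ e, 0 ≤ ((if a e ∈ V m then (1 : ℝ) else 0) - (if b e ∈ V m then 1 else 0))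
        * (f (a e) - f (b e)) := by
      intro e
      by_cases h3 : a e ∈ V m <;> by_cases h4 : b e ∈ V m <;> simp only [h3, h4, if_true, if_false]
      · simp
      · have := hin _ h3; have := hout _ h4; linarith
      · have := hin _ h4; have := hout _ h3; linarith
      · simp
    obtain ⟨e, he⟩ := hc (V m) ⟨σ ⟨0, by omega⟩, by rw [hmem]; simp; omega⟩
      ⟨σ ⟨m, h2⟩, hVn m h2⟩
    have hge : p - q ≤ ((if a e ∈ V m then (1 : ℝ) else 0) - (if b e ∈ V m then 1 else 0))
        * (f (a e) - f (b e)) := by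
      rcases he with ⟨h3, h4⟩ | ⟨h3, h4⟩ <;> simp only [h3, h4, if_true, if_false]
      · have := hin _ h3; have := hout _ h4; linarith
      · have := hin _ h4; have := hout _ h3; linarith
    have hge2 := hge.trans (Finset.single_le_sum (fun e _ => hnn e) (Finset.mem_univ e))
    have hind : ∑ i ∈ V m, indVec U i ≤ ((min m k : ℕ) : ℝ) := by
      have : ∑ i ∈ V m, indVec U i = ((V m ∩ U).card : ℝ) := by
        simp [indVec]
      rw [this]
      norm_cast
      refine le_min ?_ ?_
      · exact (Finset.card_le_card Finset.inter_subset_left).trans (hVc m h2.le).le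
      · exact Finset.card_le_card Finset.inter_subset_right
    have := mul_le_mul_of_nonneg_left hind hε.le
    simp only [hg]
    have e2 : s m = ∑ x ∈ V m, f x := rfl
    rw [e2, mul_sub]
    linarith
  have hrec : ∀ i, 1 ≤ i → i < n →
      g (i - 1) + g (i + 1) + (if i = k then 1 else 0) ≤ μ * g i := by
    intro i h1 h2
    have hx := hcross i h1 h2
    have s1 := hss i h2
    have s2 := hss (i - 1) (by omega)
    have ei : i - 1 + 1 = i := by omega
    rw [ei] at s2
    have hmin : ((min (i - 1) k : ℕ) : ℝ) + ((min (i + 1) k : ℕ) : ℝ) + (if i = k then 1 else 0)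
        = 2 * ((min i k : ℕ) : ℝ) := by
      have : min (i - 1) k + min (i + 1) k + (if i = k then 1 else 0) = 2 * min i k := by
        split_ifs <;> omega
      split_ifs at this ⊢ <;> exact_mod_cast this
    have e1 : g (i - 1) = ((min (i - 1) k : ℕ) : ℝ) - s (i - 1) := rfl
    have e2 : g (i + 1) = ((min (i + 1) k : ℕ) : ℝ) - s (i + 1) := rfl
    have e3 : g i = ((min i k : ℕ) : ℝ) - s i := rfl
    rw [hμε, add_mul, e1, e2]
    linarith
  have hmain := one_le_mul_of_supersolution hμ hg0 hj hj' hrec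
  have hle : g k ≤ dirForm K (indVec U) := by
    have e1 : g k = (k : ℝ) - s k := by simp [hg]
    have e2 : dirForm K (indVec U) = (k : ℝ) - ∑ x ∈ U, f x := by
      simp [dirForm, indVec, dotProduct, hk, ← hf]
    rw [e1, e2]
    have hkn : k - 1 < n := by omega
    set τ := f (σ ⟨k - 1, hkn⟩) with hτ
    have hin : ∀ x, x ∈ V k → τ ≤ f x := by
      intro x hx
      rw [hmem] at hx
      have := hσ (show σ.symm x ≤ ⟨k - 1, hkn⟩ by
        rw [Fin.le_def]; show ((σ.symm x : Fin n) : ℕ) ≤ k - 1; omega)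
      simpa using this
    have hout : ∀ x, x ∉ V k → f x ≤ τ := by
      intro x hx
      rw [hmem] at hx
      have := hσ (show (⟨k - 1, hkn⟩ : Fin n) ≤ σ.symm x by
        rw [Fin.le_def]; show k - 1 ≤ ((σ.symm x : Fin n) : ℕ); omega)
      simpa using this
    have h1 : ∑ x ∈ U, (f x - τ) ≤ ∑ x ∈ V k, (f x - τ) := by
      rw [← Finset.sum_inter_add_sum_sdiff U (V k)]
      have h2 : ∑ x ∈ U \ V k, (f x - τ) ≤ 0 := by
        refine Finset.sum_nonpos fun x hx => ?_
        have := hout x (Finset.mem_sdiff.1 hx).2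
        linarith
      have h3 : ∑ x ∈ U ∩ V k, (f x - τ) ≤ ∑ x ∈ V k, (f x - τ) := by
        refine Finset.sum_le_sum_of_subset_of_nonneg Finset.inter_subset_right fun x hx _ => ?_
        have := hin x hx
        linarith
      linarith
    simp only [Finset.sum_sub_distrib, Finset.sum_const, nsmul_eq_mul, hVc k (by omega), ← hk] at h1
    have e3 : s k = ∑ x ∈ V k, f x := rfl
    rw [e3]
    linarith
  by_contra hlt
  push Not at hlt
  have hpos : 0 < μ - contFrac μ j - contFrac μ j' := by
    by_contra hneg
    push Not at hneg
    have := mul_nonpos_of_nonneg_of_nonpos (hg0 k) hneg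
    linarith
  have := mul_le_mul_of_nonneg_right hle hpos.le
  linarith

end Cut

theorem exists_cut_parameter {βs lamStar lam : ℝ} (hβs : βs ^ 3 = βs + 1)
    (hstar : lamStar = Real.sqrt βs + (Real.sqrt βs)⁻¹) (hlt : lam < lamStar) :
    ∃ t : ℝ, 1.14 < t ∧ t < 1.1511 ∧ t ^ 6 < t ^ 2 + 1 ∧ lam < t + 1 / t := by
  have hb1 : 1.324 < βs := by nlinarith [sq_nonneg (βs + 1.324), sq_nonneg (βs + 1), sq_nonneg βs]
  have hb2 : βs < 1.325 := by nlinarith [sq_nonneg (βs + 1.325), sq_nonneg (βs + 1), sq_nonneg βs]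
  set s := Real.sqrt βs with hs
  have hs2 : s ^ 2 = βs := Real.sq_sqrt (by linarith)
  have hs0 : 0 ≤ s := Real.sqrt_nonneg _
  have hs1 : 1.14 < s := by nlinarith
  have hs3 : s < 1.1511 := by nlinarith
  have hcont : ContinuousAt (fun t : ℝ => t + t⁻¹) s :=
    continuousAt_id.add (continuousAt_inv₀ (by linarith))
  have hev : ∀ᶠ t in nhds s, lam < t + t⁻¹ := hcont.eventually (lt_mem_nhds (by linarith))
  have hev2 : ∀ᶠ t in nhds s, 1.14 < t := lt_mem_nhds hs1
  obtain ⟨t, ⟨h1, h2⟩, h3⟩ := (((hev.and hev2).filter_mono nhdsWithin_le_nhds).and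
    (self_mem_nhdsWithin : Set.Iio s ∈ nhdsWithin s (Set.Iio s))).exists
  have h3 : t < s := h3
  refine ⟨t, h2, by linarith, ?_, by simpa using h1⟩
  have h4 : t ^ 2 < βs := by nlinarith
  have h5 : 1.29 < t ^ 2 := by nlinarith
  have h6 : t ^ 6 = (t ^ 2) ^ 3 := by ring
  rw [h6]
  set b := t ^ 2
  nlinarith [mul_pos (sub_pos.2 h4) (show 0 < βs ^ 2 + βs * b + b ^ 2 - 1 by nlinarith)]

/-- Constants for lower bounds on cut energies. -/
structure CutConst (μ C₁ C₂ C₃ : ℝ) : Prop where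
  three : μ < C₃
  two : μ - 1 / μ < C₂
  two_two : μ + 1 < 2 * C₂
  one_two : μ < C₁ + C₂
  one : μ < 3 * C₁

/-- Lower bounds on the energies of cuts by the size of their smaller side. -/
structure CutBounds {N : Type} [Fintype N] (C₁ C₂ C₃ : ℝ) (K : Matrix N N ℝ) : Prop where
  one : ∀ U : Finset N, 1 ≤ U.card → U.card + 1 ≤ Fintype.card N → C₁ ≤ dirForm K (indVec U)
  two : ∀ U : Finset N, 2 ≤ U.card → U.card + 2 ≤ Fintype.card N → C₂ ≤ dirForm K (indVec U)
  three : ∀ U : Finset N, 3 ≤ U.card → U.card + 3 ≤ Fintype.card N → C₃ ≤ dirForm K (indVec U)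

theorem exists_cutConst_slack {t μ : ℝ} (h1 : 1.14 < t) (h2 : t < 1.1511)
    (h3 : t ^ 6 < t ^ 2 + 1) (hμ : μ = t + 1 / t) :
    ∃ η : ℝ, 0 < η ∧ CutConst μ (1 / (t - contFrac μ 0 + η)) (1 / (t - contFrac μ 1 + η))
      (1 / (t - contFrac μ 2 + η)) := by
  have ht0 : t ≠ 0 := by linarith
  have hb : (1.29 : ℝ) < t ^ 2 := by nlinarith
  have hb' : t ^ 2 < 1.3251 := by nlinarith
  have e0 : contFrac μ 0 = 0 := by simp [contFrac]
  have e1 : contFrac μ 1 = t / (t ^ 2 + 1) := by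
    have : contFrac μ 1 = 1 / μ := by simp [contFrac]
    rw [this, hμ]; field_simp
  have e1' : 1 / μ = t / (t ^ 2 + 1) := by rw [hμ]; field_simp
  have hq : t ^ 4 + t ^ 2 + 1 ≠ 0 := by positivity
  have hq' : (t ^ 2 + 1) ^ 2 - t ^ 2 ≠ 0 := by ring_nf; positivity
  have e2 : contFrac μ 2 = t * (t ^ 2 + 1) / (t ^ 4 + t ^ 2 + 1) := by
    have : contFrac μ 2 = 1 / (μ - contFrac μ 1) := rfl
    have hd : μ - contFrac μ 1 = (t ^ 4 + t ^ 2 + 1) / (t * (t ^ 2 + 1)) := by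
      rw [e1, hμ]; field_simp; ring
    rw [this, hd, one_div_div]
  have f1 : t - contFrac μ 1 = t ^ 3 / (t ^ 2 + 1) := by rw [e1]; field_simp; ring
  have f2 : t - contFrac μ 2 = t ^ 5 / (t ^ 4 + t ^ 2 + 1) := by rw [e2]; field_simp; ring
  have hc : ∀ x : ℝ, x ≠ 0 → ContinuousAt (fun η : ℝ => 1 / (x + η)) 0 := by
    intro x hx
    exact continuousAt_const.div (continuousAt_const.add continuousAt_id) (by simpa using hx)
  have c0 := hc (t - contFrac μ 0) (by rw [e0]; simpa using ht0)
  have c1 := hc (t - contFrac μ 1) (by rw [f1]; positivity)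
  have c2 := hc (t - contFrac μ 2) (by rw [f2]; positivity)
  have g0 : 1 / (t - contFrac μ 0 + 0) = 1 / t := by rw [e0]; simp
  have g1 : 1 / (t - contFrac μ 1 + 0) = (t ^ 2 + 1) / t ^ 3 := by rw [add_zero, f1, one_div_div]
  have g2 : 1 / (t - contFrac μ 2 + 0) = (t ^ 4 + t ^ 2 + 1) / t ^ 5 := by
    rw [add_zero, f2, one_div_div]
  have htp : 0 < t := by linarith
  have hμ' : μ = (t ^ 2 + 1) / t := by rw [hμ]; field_simp
  have key : ∀ {f : ℝ → ℝ} {c : ℝ}, ContinuousAt f 0 → c < f 0 →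
      ∀ᶠ η in nhdsWithin (0 : ℝ) (Set.Ioi 0), c < f η := fun hf hcf =>
    (hf.eventually (lt_mem_nhds hcf)).filter_mono nhdsWithin_le_nhds
  have k1 := key c2 (c := μ) (by
    rw [g2, hμ', div_lt_div_iff₀ htp (by positivity)]
    have : 0 < t * (t ^ 2 + 1 - t ^ 6) := mul_pos htp (by linarith)
    nlinarith)
  have k2 := key c1 (c := μ - 1 / μ) (by
    rw [g1, e1', hμ', div_sub_div _ _ ht0 (by positivity), div_lt_div_iff₀ (by positivity)
      (by positivity)]
    have : 0 < t * (t ^ 2 + 1 - t ^ 6) := mul_pos htp (by linarith)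
    nlinarith)
  have k3 := key (c1.const_mul 2) (c := μ + 1) (by
    rw [g1, hμ', div_add_one ht0, ← mul_div_assoc, div_lt_div_iff₀ htp (by positivity)]
    have : 0 < t * (2 + t ^ 2 - (t ^ 2) ^ 2 - t ^ 2 * t) := mul_pos htp (by nlinarith)
    nlinarith)
  have k4 := key (c0.add c1) (c := μ) (by
    simp only [Pi.add_apply]
    rw [g1, g0, hμ', div_add_div _ _ ht0 (by positivity), div_lt_div_iff₀ htp (by positivity)]
    have : 0 < t ^ 2 * (t ^ 2 + 1 - (t ^ 2) ^ 2) := mul_pos (by positivity) (by nlinarith)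
    nlinarith)
  have k5 := key (c0.const_mul 3) (c := μ) (by
    rw [g0, hμ', ← mul_div_assoc, div_lt_div_iff₀ htp htp]
    have : 0 < t * (2 - t ^ 2) := mul_pos (by positivity) (by nlinarith)
    nlinarith)
  obtain ⟨η, ⟨⟨⟨⟨h1, h2⟩, h3⟩, h4⟩, h5⟩, h6⟩ := (((((k1.and k2).and k3).and k4).and k5).and
    (self_mem_nhdsWithin : Set.Ioi (0 : ℝ) ∈ nhdsWithin 0 (Set.Ioi 0))).exists
  exact ⟨η, h6, h1, h2, h3, h4, h5⟩

theorem exists_cutBounds {t μ : ℝ} (h1 : 1.14 < t) (h2 : t < 1.1511)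
    (h3 : t ^ 6 < t ^ 2 + 1) (hμ : μ = t + 1 / t) :
    ∃ (C₁ C₂ C₃ : ℝ) (n₀ : ℕ), CutConst μ C₁ C₂ C₃ ∧ ∀ (N E : Type) [Fintype N] [Fintype E]
      (a b : E → N) (ε : ℝ) (K : Matrix N N ℝ), 0 < ε → μ = 2 + ε → IsResolvent a b ε K →
      CutConnected a b → n₀ ≤ Fintype.card N → CutBounds C₁ C₂ C₃ K := by
  obtain ⟨η, hη, hC⟩ := exists_cutConst_slack h1 h2 h3 hμ
  have ht1 : 1 < t := by linarith
  have hr : 1 / t ^ 2 < 1 := by rw [div_lt_one (by positivity)]; nlinarith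
  obtain ⟨m, hm2, hm⟩ : ∃ m : ℕ, 2 ≤ m ∧ (1 / t ^ 2) ^ m < η := by
    obtain ⟨m, hm⟩ := exists_pow_lt_of_lt_one hη hr
    exact ⟨m + 2, by omega,
      lt_of_le_of_lt (pow_le_pow_of_le_one (by positivity) hr.le (by omega)) hm⟩
  refine ⟨_, _, _, 2 * m + 2, hC, ?_⟩
  intro N E _ _ a b ε K hε hμε hK hc hn
  have hlt : ∀ j, contFrac μ j < μ := fun j => by
    have := (contFrac_bounds ht1 hμ j).1
    linarith
  have main : ∀ (j : ℕ) (U : Finset N), j ≤ m → j + 1 ≤ U.card → U.card + j + 1 ≤ Fintype.card N →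
      1 / (t - contFrac μ j + η) ≤ dirForm K (indVec U) := by
    intro j U hjm hj hj'
    have hb := contFrac_bounds ht1 hμ j
    have hbm := contFrac_bounds ht1 hμ m
    have hpos : 0 < t - contFrac μ j + η := by
      have : 1 / t < t := by rw [div_lt_iff₀ (by positivity)]; nlinarith
      linarith [hb.1]
    have hD : 1 ≤ dirForm K (indVec U) * (μ - contFrac μ j - contFrac μ m) := by
      by_cases hU : U.card + m + 1 ≤ Fintype.card N
      · exact one_le_dirForm_indVec_mul hε hμε hK hc hlt U hj hU
      · have := one_le_dirForm_indVec_mul hε hμε hK hc hlt U (j := m) (j' := j) (by omega) hj'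
        convert this using 2
        ring
    have hle : μ - contFrac μ j - contFrac μ m ≤ t - contFrac μ j + η := by
      linarith [hbm.2]
    have hD0 : 0 ≤ dirForm K (indVec U) := by
      rw [hK.dirForm_eq]
      have : ∀ i j, 0 ≤ K i j := hK.nonneg
      have : 0 ≤ ∑ i, ∑ j, K i j * (indVec U i - indVec U j) ^ 2 :=
        Finset.sum_nonneg fun i _ => Finset.sum_nonneg fun j _ =>
          mul_nonneg (this i j) (sq_nonneg _)
      linarith
    rw [div_le_iff₀ hpos]
    exact hD.trans (mul_le_mul_of_nonneg_left hle hD0)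
  exact ⟨fun U hU hU' => main 0 U (by omega) (by omega) (by omega),
    fun U hU hU' => main 1 U (by omega) (by omega) (by omega),
    fun U hU hU' => main 2 U (by omega) (by omega) (by omega)⟩

section Classification

variable {N E : Type} [Fintype N] [Fintype E]

/-- The integer vector with value `s` at `i` and zero elsewhere. -/
noncomputable def sgl {N : Type} (i : N) (s : ℤ) : N → ℤ := fun k => if k = i then s else 0

/-- Vectors `± e_i ± e_j` with `i ≠ j`. -/
def IsRoot {N : Type} (w : N → ℤ) : Prop :=
  ∃ i j s s', i ≠ j ∧ (s = 1 ∨ s = -1) ∧ (s' = 1 ∨ s' = -1) ∧ w = sgl i s + sgl j s'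

/-- An integer vector viewed as a real vector. -/
def castVec {N : Type} (w : N → ℤ) : N → ℝ := fun i => (w i : ℝ)

theorem IsResolvent.dirForm_mono {a b : E → N} {ε : ℝ} {K : Matrix N N ℝ}
    (hK : IsResolvent a b ε K) {ι : Type} (T : Finset ι) (v : ι → N → ℝ) (w : N → ℝ)
    (h : ∀ i j, ∑ k ∈ T, (v k i - v k j) ^ 2 ≤ (w i - w j) ^ 2) :
    ∑ k ∈ T, dirForm K (v k) ≤ dirForm K w := by
  simp only [hK.dirForm_eq, ← Finset.mul_sum]
  rw [Finset.sum_comm]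
  gcongr with i
  rw [Finset.sum_comm]
  gcongr with j
  rw [← Finset.mul_sum]
  exact mul_le_mul_of_nonneg_left (h i j) (hK.nonneg i j)

theorem IsResolvent.dirForm_congr {a b : E → N} {ε : ℝ} {K : Matrix N N ℝ}
    (hK : IsResolvent a b ε K) {c : ℝ} {v w : N → ℝ}
    (h : ∀ i j, (w i - w j) ^ 2 = c * (v i - v j) ^ 2) : dirForm K w = c * dirForm K v := by
  simp only [hK.dirForm_eq, h, Finset.mul_sum]
  refine Finset.sum_congr rfl fun i _ => Finset.sum_congr rfl fun j _ => ?_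
  ring

theorem IsResolvent.dirForm_nonneg {a b : E → N} {ε : ℝ} {K : Matrix N N ℝ}
    (hK : IsResolvent a b ε K) (w : N → ℝ) : 0 ≤ dirForm K w := by
  simpa using hK.dirForm_mono (∅ : Finset ℕ) (fun _ => 0) w (by intros; simp; positivity)

/-- The superlevel sets of an integer vector. -/
noncomputable def level (w : N → ℤ) (k : ℤ) : Finset N := Finset.univ.filter fun i => k ≤ w i

theorem mem_level {w : N → ℤ} {k : ℤ} {i : N} : i ∈ level w k ↔ k ≤ w i := by simp [level]

theorem sum_level_sq_le (T : Finset ℤ) (x y : ℤ) :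
    ∑ k ∈ T, ((if k ≤ x then (1 : ℝ) else 0) - (if k ≤ y then 1 else 0)) ^ 2
      ≤ ((x : ℝ) - y) ^ 2 := by
  wlog h : y ≤ x generalizing x y
  · have := this y x (by omega)
    convert this using 1
    · exact Finset.sum_congr rfl fun k _ => by ring
    · ring
  have h1 : ∀ k ∈ T, ((if k ≤ x then (1 : ℝ) else 0) - (if k ≤ y then 1 else 0)) ^ 2
      = if k ∈ Finset.Ioc y x then 1 else 0 := by
    intro k _
    simp only [Finset.mem_Ioc]
    split_ifs <;> first | omega | norm_num
  rw [Finset.sum_congr rfl h1, ← Finset.sum_filter, Finset.sum_const, nsmul_eq_mul, mul_one]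
  have h2 : (T.filter (· ∈ Finset.Ioc y x)).card ≤ (Finset.Ioc y x).card :=
    Finset.card_le_card fun k hk => (Finset.mem_filter.1 hk).2
  rw [Int.card_Ioc] at h2
  have h3 : ((T.filter (· ∈ Finset.Ioc y x)).card : ℤ) ≤ x - y := by omega
  have h4 : ((T.filter (· ∈ Finset.Ioc y x)).card : ℤ) ≤ (x - y) ^ 2 := by nlinarith
  exact_mod_cast h4

theorem IsResolvent.sum_level_le {a b : E → N} {ε : ℝ} {K : Matrix N N ℝ}
    (hK : IsResolvent a b ε K) (w : N → ℤ) (T : Finset ℤ) :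
    ∑ k ∈ T, dirForm K (indVec (level w k)) ≤ dirForm K (castVec w) := by
  refine hK.dirForm_mono T _ _ fun i j => ?_
  simp only [indVec, mem_level, castVec]
  exact sum_level_sq_le T _ _

theorem exists_of_card_add_one {U : Finset N} (h : U.card + 1 = Fintype.card N) :
    ∃ i, ∀ k, k ∈ U ↔ k ≠ i := by
  have : Uᶜ.card = 1 := by rw [Finset.card_compl]; omega
  obtain ⟨i, hi⟩ := Finset.card_eq_one.1 this
  refine ⟨i, fun k => ?_⟩
  have : k ∈ Uᶜ ↔ k = i := by simp [hi]
  rw [Finset.mem_compl] at this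
  tauto

theorem exists_of_card_add_two {U : Finset N} (h : U.card + 2 = Fintype.card N) :
    ∃ i j, i ≠ j ∧ ∀ k, k ∈ U ↔ k ≠ i ∧ k ≠ j := by
  have : Uᶜ.card = 2 := by rw [Finset.card_compl]; omega
  obtain ⟨i, j, hij, hi⟩ := Finset.card_eq_two.1 this
  refine ⟨i, j, hij, fun k => ?_⟩
  have : k ∈ Uᶜ ↔ k = i ∨ k = j := by simp [hi]
  rw [Finset.mem_compl] at this
  tauto

theorem classification {a b : E → N} {ε μ C₁ C₂ C₃ : ℝ} {K : Matrix N N ℝ}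
    (hK : IsResolvent a b ε K) (hC : CutConst μ C₁ C₂ C₃) (hB : CutBounds C₁ C₂ C₃ K)
    (w : N → ℤ) (hw : dirForm K (castVec w) ≤ μ) :
    ∃ (c : ℤ) (v : N → ℤ), (∀ i, w i = c + v i) ∧
      (v = 0 ∨ (∃ i s, (s = 1 ∨ s = -1) ∧ v = sgl i s) ∨ IsRoot v) := by
  by_cases hne : Nonempty N
  swap
  · exact ⟨0, 0, fun i => (hne ⟨i⟩).elim, Or.inl rfl⟩
  obtain ⟨im, him⟩ := Finite.exists_min w
  obtain ⟨iM, hiM⟩ := Finite.exists_max w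
  set m := w im with hm
  set M := w iM with hM
  have hmM : m ≤ M := him iM
  have hμ0 : 0 ≤ μ := (hK.dirForm_nonneg _).trans hw
  have hcard1 : ∀ k, k ≤ M → 1 ≤ (level w k).card := fun k hk =>
    Finset.card_pos.2 ⟨iM, mem_level.2 hk⟩
  have hcard2 : ∀ k, m < k → (level w k).card + 1 ≤ Fintype.card N := fun k hk =>
    Finset.card_lt_univ_of_notMem (x := im) (by rw [mem_level]; omega)
  have hC1 : ∀ k, m < k → k ≤ M → C₁ ≤ dirForm K (indVec (level w k)) := fun k h1 h2 =>
    hB.one _ (hcard1 k h2) (hcard2 k h1)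
  have hr3 : M < m + 3 := by
    by_contra! hcon
    have h := hK.sum_level_le w {m + 1, m + 2, m + 3}
    rw [Finset.sum_insert (by simp), Finset.sum_insert (by simp), Finset.sum_singleton] at h
    have := hC1 (m + 1) (by omega) (by omega)
    have := hC1 (m + 2) (by omega) (by omega)
    have := hC1 (m + 3) (by omega) (by omega)
    linarith [hC.one]
  obtain hr | hr | hr : M = m ∨ M = m + 1 ∨ M = m + 2 := by omega
  · exact ⟨m, 0, fun i => by have := him i; have := hiM i; simp; omega, Or.inl rfl⟩
  · have hwU : ∀ i, w i = m + if i ∈ level w (m + 1) then 1 else 0 := by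
      intro i
      have := him i; have := hiM i
      simp only [mem_level]
      split_ifs <;> omega
    have hD : dirForm K (castVec w) = 1 * dirForm K (indVec (level w (m + 1))) := by
      refine hK.dirForm_congr fun i j => ?_
      simp only [castVec, indVec]
      rw [hwU i, hwU j]
      push_cast
      split_ifs <;> ring
    rw [one_mul] at hD
    rw [hD] at hw
    have h1 := hcard1 (m + 1) (by omega)
    have h2 := hcard2 (m + 1) (by omega)
    have h3 := hB.three (level w (m + 1))
    have h4 := hC.three
    set U := level w (m + 1)
    have : U.card = 1 ∨ U.card = 2 ∨ U.card + 1 = Fintype.card N ∨ U.card + 2 = Fintype.card N := by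
      by_contra! hcon
      linarith [h3 (by omega) (by omega)]
    obtain h | h | h | h := this
    · obtain ⟨i, hi⟩ := Finset.card_eq_one.1 h
      refine ⟨m, sgl i 1, fun k => ?_, Or.inr (Or.inl ⟨i, 1, by simp, rfl⟩)⟩
      rw [hwU k, hi]
      simp [sgl]
    · obtain ⟨i, j, hij, hi⟩ := Finset.card_eq_two.1 h
      refine ⟨m, sgl i 1 + sgl j 1, fun k => ?_, Or.inr (Or.inr ⟨i, j, 1, 1, hij, by simp, by simp,
        rfl⟩)⟩
      rw [hwU k, hi]
      simp only [Finset.mem_insert, Finset.mem_singleton, sgl, Pi.add_apply]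
      split_ifs <;> first | omega | grind
    · obtain ⟨i, hi⟩ := exists_of_card_add_one h
      refine ⟨m + 1, sgl i (-1), fun k => ?_, Or.inr (Or.inl ⟨i, -1, by simp, rfl⟩)⟩
      rw [hwU k]
      simp only [hi, sgl]
      split_ifs <;> first | omega | tauto
    · obtain ⟨i, j, hij, hi⟩ := exists_of_card_add_two h
      refine ⟨m + 1, sgl i (-1) + sgl j (-1), fun k => ?_, Or.inr (Or.inr ⟨i, j, -1, -1, hij,
        by simp, by simp, rfl⟩)⟩
      rw [hwU k]
      simp only [hi, sgl, Pi.add_apply]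
      split_ifs <;> first | omega | grind
  · have hwU : ∀ i, w i = m + (if i ∈ level w (m + 1) then 1 else 0)
        + if i ∈ level w (m + 2) then 1 else 0 := by
      intro i
      have := him i; have := hiM i
      simp only [mem_level]
      split_ifs <;> omega
    have hsub : level w (m + 2) ⊆ level w (m + 1) := fun i hi => by
      rw [mem_level] at hi ⊢; omega
    have hneq : level w (m + 2) ≠ level w (m + 1) := by
      intro heq
      have hD : dirForm K (castVec w) = 4 * dirForm K (indVec (level w (m + 1))) := by
        refine hK.dirForm_congr fun i j => ?_
        simp only [castVec, indVec]
        rw [hwU i, hwU j, heq]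
        push_cast
        split_ifs <;> ring
      have := hC1 (m + 1) (by omega) (by omega)
      linarith [hC.one]
    have hs := hK.sum_level_le w {m + 1, m + 2}
    rw [Finset.sum_insert (by simp), Finset.sum_singleton] at hs
    have c1 := hC1 (m + 1) (by omega) (by omega)
    have c2 := hC1 (m + 2) (by omega) (by omega)
    have h11 := hcard1 (m + 1) (by omega)
    have h12 := hcard2 (m + 1) (by omega)
    have h21 := hcard1 (m + 2) (by omega)
    have h22 := hcard2 (m + 2) (by omega)
    have k12 := hC.one_two
    have d1 := hB.two (level w (m + 1))
    have d2 := hB.two (level w (m + 2))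
    have hlt := Finset.card_lt_card (hsub.ssubset_of_ne hneq)
    have e1 : (level w (m + 1)).card + 1 = Fintype.card N := by
      by_contra hcon
      linarith [d1 (by omega) (by omega)]
    have e2 : (level w (m + 2)).card = 1 := by
      by_contra hcon
      linarith [d2 (by omega) (by omega)]
    obtain ⟨i, hi⟩ := exists_of_card_add_one e1
    obtain ⟨j, hj⟩ := Finset.card_eq_one.1 e2
    have hji : j ≠ i := (hi j).1 (hsub (by simp [hj]))
    refine ⟨m + 1, sgl j 1 + sgl i (-1), fun k => ?_, Or.inr (Or.inr ⟨j, i, 1, -1, hji,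
      by simp, by simp, rfl⟩)⟩
    rw [hwU k, hj]
    simp only [hi, sgl, Pi.add_apply, Finset.mem_singleton]
    split_ifs <;> first | omega | grind

theorem IsRoot.le_dirForm {a b : E → N} {ε C₁ C₂ C₃ : ℝ} {K : Matrix N N ℝ}
    (hK : IsResolvent a b ε K) (hB : CutBounds C₁ C₂ C₃ K) (hn : 4 ≤ Fintype.card N)
    {w : N → ℤ} (hw : IsRoot w) : C₂ ≤ dirForm K (castVec w) := by
  obtain ⟨i, j, s, s', hij, hs, hs', rfl⟩ := hw
  have hc : ({i, j} : Finset N).card = 2 := Finset.card_pair hij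
  refine (hB.two {i, j} (by omega) (by omega)).trans ?_
  have := hK.dirForm_mono ({0} : Finset ℕ) (fun _ => indVec {i, j})
    (castVec (sgl i s + sgl j s')) (fun k l => by
      simp only [Finset.sum_singleton, indVec, castVec, sgl, Pi.add_apply, Finset.mem_insert,
        Finset.mem_singleton]
      obtain rfl | rfl := hs <;> obtain rfl | rfl := hs' <;>
      by_cases h1 : k = i <;> by_cases h2 : k = j <;> by_cases h3 : l = i <;> by_cases h4 : l = j
      all_goals first | (exfalso; grind) | (simp [h1, h2, h3, h4, hij, Ne.symm hij]; try norm_num))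
  simpa using this

theorem IsRoot.dotProduct_self {w : N → ℤ} (hw : IsRoot w) : castVec w ⬝ᵥ castVec w = 2 := by
  obtain ⟨i, j, s, s', hij, hs, hs', rfl⟩ := hw
  have : ∀ k, castVec (sgl i s + sgl j s') k * castVec (sgl i s + sgl j s') k
      = (if k = i then 1 else 0) + (if k = j then 1 else 0) := by
    intro k
    simp only [castVec, sgl, Pi.add_apply]
    obtain rfl | rfl := hs <;> obtain rfl | rfl := hs' <;>
    by_cases h1 : k = i <;> by_cases h2 : k = j
    all_goals first | (exfalso; grind) | simp [h1, h2, hij, Ne.symm hij]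
  simp only [dotProduct, this, Finset.sum_add_distrib, Finset.sum_ite_eq', Finset.mem_univ, if_true]
  norm_num

theorem IsResolvent.mulVec_nonneg {a b : E → N} {ε : ℝ} (hε : 0 < ε) {K : Matrix N N ℝ}
    (hK : IsResolvent a b ε K) (w : N → ℝ) : 0 ≤ w ⬝ᵥ K.mulVec w := by
  set z := K.mulVec w with hz
  have h : ∑ i, z i * (∑ e, edgeVec (a e) (b e) i * (z (a e) - z (b e)) + ε * z i)
      = ∑ i, z i * (ε * w i) := Finset.sum_congr rfl fun i _ => by rw [hK.eqn w i]
  simp only [mul_add, Finset.sum_add_distrib, Finset.mul_sum] at h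
  rw [Finset.sum_comm] at h
  have h1 : ∑ e, ∑ i, z i * (edgeVec (a e) (b e) i * (z (a e) - z (b e)))
      = ∑ e, (z (a e) - z (b e)) ^ 2 := by
    refine Finset.sum_congr rfl fun e _ => ?_
    rw [sq, ← edgeVec_dotProduct (a e) (b e) z, dotProduct, Finset.sum_mul]
    exact Finset.sum_congr rfl fun i _ => by ring
  have h2 : ∑ i, z i * (ε * w i) = ε * (w ⬝ᵥ z) := by
    rw [dotProduct, Finset.mul_sum]
    exact Finset.sum_congr rfl fun i _ => by ring
  rw [h1, h2] at h
  have h3 : 0 ≤ ε * (w ⬝ᵥ z) := by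
    rw [← h]
    refine add_nonneg (Finset.sum_nonneg fun _ _ => sq_nonneg _)
      (Finset.sum_nonneg fun i _ => ?_)
    nlinarith [mul_nonneg hε.le (sq_nonneg (z i))]
  exact (mul_nonneg_iff_of_pos_left hε).1 h3

end Classification

section Representation

variable {V N E : Type} [Fintype V] [Fintype N] [Fintype E]

/-- The restriction of `2 - A` to the range of `h` is the Gram matrix of the edge vectors of a
tree with node set `N` and edges `a e, b e`. -/
structure IsRep (A : Matrix V V ℝ) (h : E → V) (a b : E → N) : Prop where
  inj : Function.Injective h
  gram : ∀ e e', A (h e) (h e') = (if e = e' then 2 else 0)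
    - edgeVec (a e) (b e) ⬝ᵥ edgeVec (a e') (b e')
  lift : ∀ φ : E → ℤ, ∃ w : N → ℤ, ∀ e, φ e = w (a e) - w (b e)
  conn : CutConnected a b
  card : Fintype.card N = Fintype.card E + 1

theorem IsRep.dirForm_le {A : Matrix V V ℝ} {h : E → V} {a b : E → N} (hr : IsRep A h a b)
    (hA : A.IsSymm) {μ ε : ℝ} (hμε : μ = 2 + ε) (hε : 0 < ε)
    (hq : ∀ x : V → ℝ, x ⬝ᵥ A.mulVec x ≤ μ * (x ⬝ᵥ x)) {K : Matrix N N ℝ}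
    (hK : IsResolvent a b ε K) (z : V → ℝ) (hz : ∀ e, z (h e) = 0) (W : N → ℝ)
    (hW : ∀ e, -(A.mulVec z) (h e) = W (a e) - W (b e)) :
    dirForm K W ≤ μ * (z ⬝ᵥ z) - z ⬝ᵥ A.mulVec z := by
  set u : N → ℝ := K.mulVec W with hu
  set y : E → ℝ := fun e => (u (a e) - u (b e)) / ε with hy
  set X : V → ℝ := fun v => ∑ e, if v = h e then y e else 0 with hX
  have hXdot : ∀ f : V → ℝ, X ⬝ᵥ f = ∑ e, y e * f (h e) := by
    intro f
    simp only [dotProduct, hX, Finset.sum_mul]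
    rw [Finset.sum_comm]
    exact Finset.sum_congr rfl fun e _ => by simp [ite_mul]
  have hXh : ∀ e, X (h e) = y e := by
    intro e
    simp only [hX, hr.inj.eq_iff]
    simp
  have hdotX : ∀ f : V → ℝ, f ⬝ᵥ X = ∑ e, f (h e) * y e := by
    intro f
    rw [dotProduct_comm, hXdot]
    exact Finset.sum_congr rfl fun e _ => mul_comm _ _
  have hAX : ∀ e, (A.mulVec X) (h e)
      = 2 * y e - edgeVec (a e) (b e) ⬝ᵥ fun i => ∑ e', edgeVec (a e') (b e') i * y e' := by
    intro e
    have h1 : (A.mulVec X) (h e) = ∑ e', A (h e) (h e') * y e' := hdotX _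
    rw [h1]
    simp only [hr.gram, sub_mul, Finset.sum_sub_distrib, ite_mul, zero_mul, Finset.sum_ite_eq,
      Finset.mem_univ, if_true]
    congr 1
    simp only [dotProduct, Finset.sum_mul, Finset.mul_sum]
    rw [Finset.sum_comm]
    exact Finset.sum_congr rfl fun i _ => Finset.sum_congr rfl fun e' _ => by ring
  have hby : ∀ i, ∑ e', edgeVec (a e') (b e') i * y e' = W i - u i := by
    intro i
    have h1 := hK.eqn W i
    have h2 : ∑ e', edgeVec (a e') (b e') i * y e'
        = (∑ e, edgeVec (a e) (b e) i * (u (a e) - u (b e))) / ε := by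
      rw [Finset.sum_div]
      exact Finset.sum_congr rfl fun e _ => by simp only [hy]; ring
    rw [h2, div_eq_iff hε.ne']
    linarith
  have hAX' : ∀ e, (A.mulVec X) (h e)
      = 2 * y e - ((W (a e) - u (a e)) - (W (b e) - u (b e))) := by
    intro e
    rw [hAX, edgeVec_dotProduct, hby, hby]
  have hsum : ∀ f : N → ℝ, ∑ e, y e * (f (a e) - f (b e)) = f ⬝ᵥ (W - u) := by
    intro f
    have : ∀ e, y e * (f (a e) - f (b e)) = ∑ i, f i * (edgeVec (a e) (b e) i * y e) := by
      intro e
      rw [← edgeVec_dotProduct (a e) (b e) f, dotProduct, Finset.mul_sum]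
      exact Finset.sum_congr rfl fun i _ => by ring
    simp only [this]
    rw [Finset.sum_comm]
    simp only [dotProduct, Pi.sub_apply, ← hby, Finset.mul_sum]
  have hyy : ε * ∑ e, y e * y e = u ⬝ᵥ (W - u) := by
    rw [← hsum, Finset.mul_sum]
    refine Finset.sum_congr rfl fun e _ => ?_
    have : ε * y e = u (a e) - u (b e) := by simp only [hy]; field_simp
    rw [← this]; ring
  have hzX : z ⬝ᵥ X = 0 := by simp [hdotX, hz]
  have hsymm : z ⬝ᵥ A.mulVec X = X ⬝ᵥ A.mulVec z := by
    rw [dotProduct_comm, ← Matrix.vecMul_transpose, hA.eq, Matrix.dotProduct_mulVec]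
  have hXAz : X ⬝ᵥ A.mulVec z = -(W ⬝ᵥ (W - u)) := by
    rw [hXdot, ← hsum, ← Finset.sum_neg_distrib]
    refine Finset.sum_congr rfl fun e _ => ?_
    rw [← hW]; ring
  have hXX : X ⬝ᵥ X = ∑ e, y e * y e := by
    rw [hXdot]; exact Finset.sum_congr rfl fun e _ => by rw [hXh]
  have hXAX : X ⬝ᵥ A.mulVec X = 2 * ∑ e, y e * y e - (W - u) ⬝ᵥ (W - u) := by
    rw [hXdot, ← hsum (W - u), Finset.mul_sum, ← Finset.sum_sub_distrib]
    refine Finset.sum_congr rfl fun e _ => ?_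
    rw [hAX']; simp only [Pi.sub_apply]; ring
  have key := hq (z - X)
  simp only [Matrix.mulVec_sub, dotProduct_sub, sub_dotProduct] at key
  rw [hsymm, hXAz, hXX, hXAX, hzX, dotProduct_comm X z, hzX] at key
  have hD : dirForm K W = W ⬝ᵥ W - W ⬝ᵥ u := rfl
  simp only [dotProduct_sub, sub_dotProduct] at key hyy
  have hc : u ⬝ᵥ W = W ⬝ᵥ u := dotProduct_comm _ _
  rw [hμε] at key ⊢
  rw [hc] at key hyy
  rw [hD]
  nlinarith

end Representation

section Structure

variable {V N E : Type} [Fintype V] [Fintype N] [Fintype E]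

/-- Symmetric matrices with zero diagonal and entries in `{-1, 0, 1}`. -/
structure IsSigned {V : Type} (A : Matrix V V ℝ) : Prop where
  symm : A.IsSymm
  diag : ∀ i, A i i = 0
  entries : ∀ i j, A i j = -1 ∨ A i j = 0 ∨ A i j = 1

theorem IsSigned.exists_int {V : Type} {A : Matrix V V ℝ} (hA : IsSigned A) (i j : V) :
    ∃ k : ℤ, A i j = k := by
  obtain h | h | h := hA.entries i j
  · exact ⟨-1, by simp [h]⟩
  · exact ⟨0, by simp [h]⟩
  · exact ⟨1, by simp [h]⟩

/-- The integer vector `w` represents the row of `u` on the tree. -/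
def IsLift {V N E : Type} (A : Matrix V V ℝ) (h : E → V) (a b : E → N) (u : V) (w : N → ℤ) :
    Prop :=
  ∀ e, -A u (h e) = (w (a e) : ℝ) - w (b e)

theorem IsRep.exists_isLift {V : Type} {A : Matrix V V ℝ} {h : E → V} {a b : E → N}
    (hr : IsRep A h a b) (hA : IsSigned A) (u : V) : ∃ w, IsLift A h a b u w := by
  choose φ hφ using fun e => hA.exists_int u (h e)
  obtain ⟨w, hw⟩ := hr.lift fun e => -φ e
  refine ⟨w, fun e => ?_⟩
  rw [hφ e]
  exact_mod_cast hw e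

theorem IsRep.pair_le {A : Matrix V V ℝ} {h : E → V} {a b : E → N} (hr : IsRep A h a b)
    (hA : IsSigned A) {μ ε : ℝ} (hμε : μ = 2 + ε) (hε : 0 < ε)
    (hq : ∀ x : V → ℝ, x ⬝ᵥ A.mulVec x ≤ μ * (x ⬝ᵥ x)) {K : Matrix N N ℝ}
    (hK : IsResolvent a b ε K) {u u' : V} (huu' : u ≠ u') (hu : ∀ e, h e ≠ u)
    (hu' : ∀ e, h e ≠ u') {w w' : N → ℤ} (hw : IsLift A h a b u w)
    (hw' : IsLift A h a b u' w') (α : ℝ) :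
    dirForm K (castVec w + α • castVec w') ≤ μ * (1 + α ^ 2) - 2 * α * A u u' := by
  have hs : A u' u = A u u' := hA.symm.apply u u'
  have hm : A.mulVec (Pi.single u 1 + α • Pi.single u' 1) = fun v => A v u + α * A v u' := by
    ext v
    simp [Matrix.mulVec_add, Matrix.mulVec_smul, Matrix.mulVec_single]
  have := hr.dirForm_le hA.symm hμε hε hq hK (Pi.single u 1 + α • Pi.single u' 1)
    (fun e => by simp [hu e, hu' e]) (castVec w + α • castVec w') (fun e => by
      rw [hm]
      have h1 := hw e
      have h2 := hw' e
      rw [← hA.symm.apply] at h1 h2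
      simp only [Pi.add_apply, Pi.smul_apply, castVec, smul_eq_mul]
      linear_combination h1 + α * h2)
  rw [hm] at this
  refine this.trans (le_of_eq ?_)
  simp only [add_dotProduct, smul_dotProduct, single_dotProduct, Pi.add_apply, Pi.smul_apply,
    Pi.single_eq_same, smul_eq_mul, Pi.single_eq_of_ne huu', Pi.single_eq_of_ne huu'.symm,
    hA.diag, hs]
  ring

theorem IsRep.single_le {A : Matrix V V ℝ} {h : E → V} {a b : E → N} (hr : IsRep A h a b)
    (hA : IsSigned A) {μ ε : ℝ} (hμε : μ = 2 + ε) (hε : 0 < ε)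
    (hq : ∀ x : V → ℝ, x ⬝ᵥ A.mulVec x ≤ μ * (x ⬝ᵥ x)) {K : Matrix N N ℝ}
    (hK : IsResolvent a b ε K) {u : V} (hu : ∀ e, h e ≠ u) {w : N → ℤ}
    (hw : IsLift A h a b u w) : dirForm K (castVec w) ≤ μ := by
  have hm : A.mulVec (Pi.single u 1) = fun v => A v u := by
    ext v
    simp [Matrix.mulVec_single]
  have := hr.dirForm_le hA.symm hμε hε hq hK (Pi.single u 1)
    (fun e => by simp [hu e]) (castVec w) (fun e => by
      rw [hm]
      have h1 := hw e
      rw [← hA.symm.apply] at h1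
      simpa [castVec] using h1)
  rw [hm] at this
  simpa [hA.diag] using this

theorem IsResolvent.dirForm_add_smul {a b : E → N} {ε : ℝ} {K : Matrix N N ℝ}
    (hK : IsResolvent a b ε K) (v w : N → ℝ) (α : ℝ) :
    dirForm K (v + α • w) = dirForm K v + α ^ 2 * dirForm K w
      + 2 * α * (v ⬝ᵥ w - v ⬝ᵥ K.mulVec w) := by
  have h : w ⬝ᵥ K.mulVec v = v ⬝ᵥ K.mulVec w := by
    rw [dotProduct_comm, ← Matrix.vecMul_transpose, hK.symm, Matrix.dotProduct_mulVec]
  simp only [dirForm, Matrix.mulVec_add, Matrix.mulVec_smul, dotProduct_add, add_dotProduct,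
    dotProduct_smul, smul_dotProduct, smul_eq_mul, h, dotProduct_comm w v]
  ring

theorem IsRep.apply_eq_of_isRoot {A : Matrix V V ℝ} {h : E → V} {a b : E → N}
    (hr : IsRep A h a b) (hA : IsSigned A) {μ ε : ℝ} (hμε : μ = 2 + ε) (hε : 0 < ε)
    (hq : ∀ x : V → ℝ, x ⬝ᵥ A.mulVec x ≤ μ * (x ⬝ᵥ x)) {K : Matrix N N ℝ}
    (hK : IsResolvent a b ε K) {C₁ C₂ C₃ : ℝ} (hC : CutConst μ C₁ C₂ C₃)
    (hB : CutBounds C₁ C₂ C₃ K) (hn : 4 ≤ Fintype.card N)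
    {u u' : V} (huu' : u ≠ u') (hu : ∀ e, h e ≠ u)
    (hu' : ∀ e, h e ≠ u') {w w' : N → ℤ} (hw : IsLift A h a b u w)
    (hw' : IsLift A h a b u' w') (hwr : IsRoot w) (hwr' : IsRoot w') :
    A u u' = -(castVec w ⬝ᵥ castVec w') := by
  have p1 := hr.pair_le hA hμε hε hq hK huu' hu hu' hw hw' 1
  have p2 := hr.pair_le hA hμε hε hq hK huu' hu hu' hw hw' (-1)
  rw [hK.dirForm_add_smul] at p1 p2
  have q1 := hK.mulVec_nonneg hε (castVec w + (1 : ℝ) • castVec w')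
  have q2 := hK.mulVec_nonneg hε (castVec w + (-1 : ℝ) • castVec w')
  have d1 := hwr.le_dirForm hK hB hn
  have d2 := hwr'.le_dirForm hK hB hn
  have s1 := hwr.dotProduct_self
  have s2 := hwr'.dotProduct_self
  have h : castVec w' ⬝ᵥ K.mulVec (castVec w) = castVec w ⬝ᵥ K.mulVec (castVec w') := by
    rw [dotProduct_comm, ← Matrix.vecMul_transpose, hK.symm, Matrix.dotProduct_mulVec]
  simp only [Matrix.mulVec_add, Matrix.mulVec_smul, dotProduct_add, add_dotProduct,
    dotProduct_smul, smul_dotProduct, smul_eq_mul, h] at q1 q2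
  have e1 : dirForm K (castVec w) = castVec w ⬝ᵥ castVec w - castVec w ⬝ᵥ K.mulVec (castVec w) :=
    rfl
  have e2 : dirForm K (castVec w')
    = castVec w' ⬝ᵥ castVec w' - castVec w' ⬝ᵥ K.mulVec (castVec w') := rfl
  have h22 := hC.two_two
  obtain ⟨k, hk⟩ := hA.exists_int u u'
  obtain ⟨d, hd⟩ : ∃ d : ℤ, castVec w ⬝ᵥ castVec w' = d := by
    refine ⟨w ⬝ᵥ w', ?_⟩
    simp [dotProduct, castVec]
  rw [hd] at p1 p2 ⊢
  rw [hk] at p1 p2 ⊢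
  have : k = -d := by
    obtain hlt | heq | hgt := lt_trichotomy k (-d)
    · exfalso
      have : (k : ℝ) + 1 ≤ -d := by exact_mod_cast hlt
      linarith
    · exact heq
    · exfalso
      have : (-d : ℝ) + 1 ≤ k := by exact_mod_cast hgt
      linarith
  rw [this]
  push_cast
  ring

theorem IsRep.apply_eq_zero_of_isRoot {A : Matrix V V ℝ} {h : E → V} {a b : E → N}
    (hr : IsRep A h a b) (hA : IsSigned A) {μ ε : ℝ} (hμε : μ = 2 + ε) (hε : 0 < ε)
    (hq : ∀ x : V → ℝ, x ⬝ᵥ A.mulVec x ≤ μ * (x ⬝ᵥ x)) {K : Matrix N N ℝ}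
    (hK : IsResolvent a b ε K) {C₁ C₂ C₃ : ℝ} (hC : CutConst μ C₁ C₂ C₃)
    (hB : CutBounds C₁ C₂ C₃ K) (hn : 4 ≤ Fintype.card N)
    {u u' : V} (huu' : u ≠ u') (hu : ∀ e, h e ≠ u)
    (hu' : ∀ e, h e ≠ u') {w : N → ℤ} (hw : IsLift A h a b u w)
    (hw' : IsLift A h a b u' 0) (hwr : IsRoot w) : A u u' = 0 := by
  have d1 := hwr.le_dirForm hK hB hn
  have h2 := hC.two
  have hz : castVec (0 : N → ℤ) = 0 := by ext; simp [castVec]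
  have hμ : 0 < μ := by linarith
  have p1 := hr.pair_le hA hμε hε hq hK huu' hu hu' hw hw' (A u u' / μ)
  rw [hz, smul_zero, add_zero] at p1
  have e1 : μ * (1 + (A u u' / μ) ^ 2) - 2 * (A u u' / μ) * A u u' = μ - A u u' ^ 2 * (1 / μ) := by
    field_simp
    ring
  rw [e1] at p1
  obtain h | h | h := hA.entries u u'
  · rw [h] at p1; norm_num at p1 h2; linarith
  · exact h
  · rw [h] at p1; norm_num at p1 h2; linarith

theorem edgeVec_some (a b : N) (W : Option N → ℝ) :
    edgeVec (some a) (some b) ⬝ᵥ W = edgeVec a b ⬝ᵥ fun x => W (some x) := by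
  rw [edgeVec_dotProduct, edgeVec_dotProduct]

/-- Attaching a leaf to the tree. -/
theorem IsRep.extend {V : Type} {A : Matrix V V ℝ} {h : E → V} {a b : E → N}
    (hr : IsRep A h a b) (hA : IsSigned A) {u : V} (hu : ∀ e, h e ≠ u) {i : N} {s : ℤ}
    (hs : s = 1 ∨ s = -1) (hw : IsLift A h a b u (sgl i s)) :
    ∃ a' b' : Option E → Option N, IsRep A (fun o => o.elim u h) a' b' ∧
      ∃ x y, (x = none ∧ y = some i ∨ x = some i ∧ y = none) ∧ a' = (fun o => o.elim x (some ∘ a)) ∧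
        b' = (fun o => o.elim y (some ∘ b)) := by
  have hconn : ∀ x y : Option N, (x = none ∧ y = some i ∨ x = some i ∧ y = none) →
      CutConnected (fun o : Option E => o.elim x (some ∘ a))
        (fun o => o.elim y (some ∘ b)) := by
    intro x y hxy U hU hU'
    set U₀ : Finset N := Finset.univ.filter fun k => some k ∈ U with hU₀
    have hm : ∀ k, k ∈ U₀ ↔ some k ∈ U := by simp [hU₀]
    by_cases h1 : U₀.Nonempty ∧ ∃ k, k ∉ U₀
    · obtain ⟨e, he⟩ := hr.conn U₀ h1.1 h1.2
      simp only [hm] at he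
      exact ⟨some e, by simpa using he⟩
    · refine ⟨none, ?_⟩
      obtain ⟨p, hp⟩ := hU
      obtain ⟨q, hq⟩ := hU'
      have : (none ∈ U ∧ some i ∉ U) ∨ (none ∉ U ∧ some i ∈ U) := by
        by_cases hn : U₀.Nonempty
        · have h2 : ∀ k, some k ∈ U := fun k => by
            by_contra hk
            exact h1 ⟨hn, k, by rwa [hm]⟩
          right
          refine ⟨?_, h2 i⟩
          cases q with
          | none => exact hq
          | some q => exact (hq (h2 q)).elim
        · have h2 : ∀ k, some k ∉ U := fun k hk => hn ⟨k, by rwa [hm]⟩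
          left
          refine ⟨?_, h2 i⟩
          cases p with
          | none => exact hp
          | some p => exact (h2 p hp).elim
      simp only [Option.elim_none]
      obtain ⟨rfl, rfl⟩ | ⟨rfl, rfl⟩ := hxy <;> tauto
  have hcard : Fintype.card (Option N) = Fintype.card (Option E) + 1 := by
    simp [hr.card]
  have hinj : Function.Injective fun o : Option E => o.elim u h := by
    intro o o' ho
    cases o <;> cases o' <;> simp only [Option.elim_none, Option.elim_some] at ho
    · rfl
    · exact (hu _ ho.symm).elim
    · exact (hu _ ho).elim
    · rw [hr.inj ho]
  have hgram : ∀ x y : Option N, x ≠ y →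
      (∀ e, -A u (h e) = edgeVec x y ⬝ᵥ edgeVec (some (a e)) (some (b e))) →
      ∀ o o' : Option E, A (o.elim u h) (o'.elim u h)
        = (@ite ℝ (o = o') (propDecidable _) 2 0)
        - edgeVec (o.elim x (some ∘ a)) (o.elim y (some ∘ b)) ⬝ᵥ
          edgeVec (o'.elim x (some ∘ a)) (o'.elim y (some ∘ b)) := by
    intro x y hxy hxye o o'
    cases o with
    | none =>
      cases o' with
      | none =>
        simp only [Option.elim_none, hA.diag, edgeVec_dotProduct]
        simp [edgeVec, hxy, hxy.symm]
        norm_num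
      | some e =>
        simp only [Option.elim_none, Option.elim_some, Function.comp, ← hxye]
        simp
    | some e =>
      cases o' with
      | none =>
        simp only [Option.elim_none, Option.elim_some, Function.comp]
        rw [dotProduct_comm, ← hxye, ← hA.symm.apply]
        simp
      | some e' =>
        simp only [Option.elim_some, Function.comp, hr.gram, Option.some_inj]
        rw [edgeVec_some]
        congr 2
        funext k
        simp [edgeVec]
  have hlift : ∀ x y : Option N, (s = -1 ∧ x = none ∧ y = some i ∨ s = 1 ∧ x = some i ∧ y = none) →
      ∀ φ : Option E → ℤ, ∃ w : Option N → ℤ, ∀ o : Option E,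
        φ o = w (o.elim x (some ∘ a)) - w (o.elim y (some ∘ b)) := by
    intro x y hxy φ
    obtain ⟨w, hw⟩ := hr.lift fun e => φ (some e)
    refine ⟨fun o => o.elim (w i - s * φ none) w, fun o => ?_⟩
    cases o with
    | none => obtain ⟨rfl, rfl, rfl⟩ | ⟨rfl, rfl, rfl⟩ := hxy <;> simp
    | some e => simpa using hw e
  obtain rfl | rfl := hs
  · refine ⟨_, _, ⟨hinj, hgram (some i) none (by simp) fun e => ?_, hlift _ _ (by simp),
      hconn _ _ (by simp), hcard⟩, some i, none, by simp, rfl, rfl⟩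
    rw [hw e, dotProduct_comm, edgeVec_dotProduct]
    simp [sgl, edgeVec]
  · refine ⟨_, _, ⟨hinj, hgram none (some i) (by simp) fun e => ?_, hlift _ _ (by simp),
      hconn _ _ (by simp), hcard⟩, none, some i, by simp, rfl, rfl⟩
    rw [hw e, dotProduct_comm, edgeVec_dotProduct]
    simp [sgl, edgeVec]
    split_ifs <;> simp

end Structure

section RootSystem

/-- A matrix is connected if every nontrivial cut is crossed by a nonzero entry. -/
def IsConn {V : Type} (A : Matrix V V ℝ) : Prop :=
  ∀ S : Set V, S.Nonempty → Sᶜ.Nonempty → ∃ u ∈ S, ∃ v ∈ Sᶜ, A u v ≠ 0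

/-- `2 - A` is, off the diagonal, the Gram matrix of roots `± e_i ± e_j` on the node set `N`,
which include the edges of a spanning tree. -/
structure IsRootSystem {V N E : Type} [Fintype V] [Fintype N] [Fintype E] (A : Matrix V V ℝ)
    (h : E → V) (a b : E → N) (w : V → N → ℤ) : Prop where
  rep : IsRep A h a b
  root : ∀ u, IsRoot (w u)
  gram : ∀ u v, u ≠ v → A u v = -(castVec (w u) ⬝ᵥ castVec (w v))
  tree : ∀ e, castVec (w (h e)) = edgeVec (a e) (b e)

theorem castVec_sgl {N : Type} (a b : N) :
    castVec (sgl a 1 + sgl b (-1)) = edgeVec a b := by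
  funext k
  simp only [castVec, sgl, edgeVec, Pi.add_apply]
  push_cast
  split_ifs <;> norm_num

theorem IsRep.ne {V N E : Type} [Fintype N] [Fintype E] {A : Matrix V V ℝ} {h : E → V}
    {a b : E → N} (hr : IsRep A h a b) (hA : IsSigned A) (e : E) : a e ≠ b e := by
  intro hab
  have := hr.gram e e
  rw [hA.diag, edgeVec_dotProduct] at this
  simp [edgeVec, hab] at this

theorem IsRep.exists_maximal {V : Type} [Fintype V] {A : Matrix V V ℝ} (hA : IsSigned A) (k : ℕ) :
    ∀ (N E : Type) [Fintype N] [Fintype E] (h : E → V) (a b : E → N), IsRep A h a b →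
      Fintype.card V + 1 ≤ Fintype.card N + k →
      ∃ (N' E' : Type) (_ : Fintype N') (_ : Fintype E') (h' : E' → V) (a' b' : E' → N'),
        IsRep A h' a' b' ∧ Fintype.card N ≤ Fintype.card N' ∧
        ∀ u, (∀ e, h' e ≠ u) → ∀ i s, (s = 1 ∨ s = -1) → ¬ IsLift A h' a' b' u (sgl i s) := by
  induction k with
  | zero =>
    intro N E _ _ h a b hr hk
    refine ⟨N, E, inferInstance, inferInstance, h, a, b, hr, le_rfl, fun u hu => ?_⟩
    have h1 : Fintype.card E = Fintype.card V :=
      le_antisymm (Fintype.card_le_of_injective h hr.inj) (by have := hr.card; omega)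
    obtain ⟨e, he⟩ := ((Fintype.bijective_iff_injective_and_card h).2 ⟨hr.inj, h1⟩).2 u
    exact (hu e he).elim
  | succ k ih =>
    intro N E _ _ h a b hr hk
    by_cases hext : ∀ u, (∀ e, h e ≠ u) → ∀ i s, (s = 1 ∨ s = -1) →
        ¬ IsLift A h a b u (sgl i s)
    · exact ⟨N, E, inferInstance, inferInstance, h, a, b, hr, le_rfl, hext⟩
    · push Not at hext
      obtain ⟨u, hu, i, s, hs, hw⟩ := hext
      obtain ⟨a', b', hr', -⟩ := hr.extend hA hu hs hw
      obtain ⟨N', E', i1, i2, h', a'', b'', hr'', hc, hmax⟩ :=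
        ih (Option N) (Option E) _ a' b' hr' (by rw [Fintype.card_option]; omega)
      exact ⟨N', E', i1, i2, h', a'', b'', hr'', by rw [Fintype.card_option] at hc; omega, hmax⟩

theorem exists_isRootSystem {V N E : Type} [Fintype V] [Fintype N] [Fintype E]
    {A : Matrix V V ℝ} {h : E → V} {a b : E → N} (hr : IsRep A h a b)
    (hA : IsSigned A) (hconn : IsConn A) {μ ε : ℝ} (hμε : μ = 2 + ε) (hε : 0 < ε)
    (hq : ∀ x : V → ℝ, x ⬝ᵥ A.mulVec x ≤ μ * (x ⬝ᵥ x)) {C₁ C₂ C₃ : ℝ} {n₀ : ℕ}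
    (hC : CutConst μ C₁ C₂ C₃)
    (hB : ∀ (N E : Type) [Fintype N] [Fintype E]
      (a b : E → N) (ε : ℝ) (K : Matrix N N ℝ), 0 < ε → μ = 2 + ε → IsResolvent a b ε K →
      CutConnected a b → n₀ ≤ Fintype.card N → CutBounds C₁ C₂ C₃ K)
    (hn : n₀ ≤ Fintype.card N) (hn4 : 4 ≤ Fintype.card N) :
    ∃ (N' E' : Type) (_ : Fintype N') (_ : Fintype E') (h' : E' → V) (a' b' : E' → N')
      (w : V → N' → ℤ), Fintype.card N ≤ Fintype.card N' ∧ IsRootSystem A h' a' b' w := by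
  obtain ⟨N', E', i1, i2, h', a', b', hr', hc, hmax⟩ :=
    IsRep.exists_maximal hA (Fintype.card V + 1) N E h a b hr (by omega)
  obtain ⟨K, hK⟩ := exists_isResolvent a' b' hε
  have hB' := hB N' E' a' b' ε K hε hμε hK hr'.conn (by omega)
  have h1 : ∀ u, ∃ v, IsLift A h' a' b' u v ∧ ((∀ e, h' e ≠ u) → (v = 0 ∨ IsRoot v)) := by
    intro u
    obtain ⟨w, hw⟩ := hr'.exists_isLift hA u
    by_cases hu : ∀ e, h' e ≠ u
    · obtain ⟨c, v, hcv, hv⟩ := classification hK hC hB' w (hr'.single_le hA hμε hε hq hK hu hw)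
      have hv' : IsLift A h' a' b' u v := fun e => by
        rw [hw e, hcv, hcv (b' e)]; push_cast; ring
      refine ⟨v, hv', fun _ => ?_⟩
      obtain h | ⟨i, s, hs, rfl⟩ | h := hv
      · exact Or.inl h
      · exact (hmax u hu i s hs hv').elim
      · exact Or.inr h
    · exact ⟨w, hw, fun h => (hu h).elim⟩
  choose w₀ hw₀ hw₀r using h1
  have hE : 0 < Fintype.card E' := by have := hr'.card; omega
  obtain ⟨e₀⟩ := Fintype.card_pos_iff.1 hE
  have h2 : ∀ u, (∀ e, h' e ≠ u) → IsRoot (w₀ u) := by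
    by_contra! hcon
    set S : Set V := {u | (∀ e, h' e ≠ u) ∧ ¬ IsRoot (w₀ u)} with hS
    obtain ⟨u, ⟨huS, hu0⟩, v, hv, huv⟩ := hconn S hcon ⟨h' e₀, fun hh => hh.1 e₀ rfl⟩
    have hu : w₀ u = 0 := (hw₀r u huS).resolve_right hu0
    by_cases hvr : ∀ e, h' e ≠ v
    · have hvroot : IsRoot (w₀ v) := by
        by_contra hcon
        exact hv ⟨hvr, hcon⟩
      have := hr'.apply_eq_zero_of_isRoot hA hμε hε hq hK hC hB' (by omega) (u := v) (u' := u)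
        (fun hvu => hv (hvu ▸ ⟨huS, hu0⟩)) hvr huS (hw₀ v) (hu ▸ hw₀ u) hvroot
      rw [hA.symm.apply] at this
      exact huv this
    · push Not at hvr
      obtain ⟨e, rfl⟩ := hvr
      have := hw₀ u e
      rw [hu] at this
      simp at this
      exact huv this
  set w : V → N' → ℤ := fun u => if hu : ∃ e, h' e = u then
    sgl (a' hu.choose) 1 + sgl (b' hu.choose) (-1) else w₀ u with hw
  have hwe : ∀ e, w (h' e) = sgl (a' e) 1 + sgl (b' e) (-1) := by
    intro e
    have hex : ∃ e', h' e' = h' e := ⟨e, rfl⟩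
    have : hex.choose = e := hr'.inj hex.choose_spec
    simp only [hw, dif_pos hex, this]
  have hwu : ∀ u, (∀ e, h' e ≠ u) → w u = w₀ u := by
    intro u hu
    simp only [hw]
    rw [dif_neg (by simpa using hu)]
  have hmixed : ∀ u e, (∀ e, h' e ≠ u) →
      A u (h' e) = -(castVec (w u) ⬝ᵥ castVec (w (h' e))) := by
    intro u e hu
    rw [hwe, castVec_sgl, dotProduct_comm, edgeVec_dotProduct, hwu u hu, ← neg_eq_iff_eq_neg,
      hw₀ u e]
    rfl
  refine ⟨N', E', i1, i2, h', a', b', w, hc, hr', fun u => ?_, fun u v huv => ?_, fun e => ?_⟩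
  · by_cases hu : ∀ e, h' e ≠ u
    · rw [hwu u hu]; exact h2 u hu
    · push Not at hu
      obtain ⟨e, rfl⟩ := hu
      rw [hwe]
      exact ⟨a' e, b' e, 1, -1, hr'.ne hA e, by simp, by simp, rfl⟩
  · by_cases hu : ∀ e, h' e ≠ u
    · by_cases hv : ∀ e, h' e ≠ v
      · rw [hwu u hu, hwu v hv]
        exact hr'.apply_eq_of_isRoot hA hμε hε hq hK hC hB' (by omega) huv hu hv (hw₀ u) (hw₀ v)
          (h2 u hu) (h2 v hv)
      · push Not at hv
        obtain ⟨e, rfl⟩ := hv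
        exact hmixed u e hu
    · push Not at hu
      obtain ⟨e, rfl⟩ := hu
      by_cases hv : ∀ e, h' e ≠ v
      · rw [dotProduct_comm, ← hmixed v e hv, hA.symm.apply]
      · push Not at hv
        obtain ⟨e', rfl⟩ := hv
        rw [hr'.gram, hwe, hwe, castVec_sgl, castVec_sgl, if_neg (fun hee => huv (by rw [hee]))]
        ring
  · rw [hwe, castVec_sgl]

end RootSystem

section Path

variable {V : Type} [Fintype V]

/-- `c` is a proper coloring: positive edges are monochromatic, negative edges are not. -/
def IsProper {V : Type} (A : Matrix V V ℝ) {p : ℕ} (c : V → Fin p) : Prop :=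
  ∀ i j, (A i j = 1 → c i = c j) ∧ (A i j = -1 → c i ≠ c j)

theorem IsProper.card_le {A : Matrix V V ℝ} (hA : IsSigned A) {p : ℕ} {c : V → Fin p}
    (hc : IsProper A c) {lam : ℝ} (h0 : 0 < lam) (h5 : lam ^ 2 < 5)
    (hq : ∀ x : V → ℝ, x ⬝ᵥ A.mulVec x ≤ lam * (x ⬝ᵥ x)) (v : V) (s : ℝ) (hs : s ^ 2 = 1)
    (T : Finset V) (k : Fin p) (hT : ∀ t ∈ T, A v t = s ∧ c t = k) : T.card ≤ 4 := by
  have hvT : v ∉ T := by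
    intro hv
    have := (hT v hv).1
    rw [hA.diag] at this
    subst this
    norm_num at hs
  have hm : ∀ u, A.mulVec (indVec T) u = ∑ t ∈ T, A u t := by
    intro u
    simp [Matrix.mulVec, dotProduct, indVec, Finset.sum_ite_mem]
  have hdot : ∀ f : V → ℝ, indVec T ⬝ᵥ f = ∑ t ∈ T, f t := by
    intro f
    simp [dotProduct, indVec, Finset.sum_ite_mem]
  have hcol : ∀ r : ℝ, A.mulVec (Pi.single v r) = fun u => A u v * r := by
    intro r
    ext u
    simp [Matrix.mulVec_single]
  have h1 : ∑ t ∈ T, A v t = T.card * s := by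
    rw [Finset.sum_congr rfl fun t ht => (hT t ht).1]; simp
  have h2 : 0 ≤ ∑ t ∈ T, ∑ t' ∈ T, A t t' := by
    refine Finset.sum_nonneg fun t ht => Finset.sum_nonneg fun t' ht' => ?_
    obtain h | h | h := hA.entries t t'
    · exact ((hc t t').2 h ((hT t ht).2.trans (hT t' ht').2.symm)).elim
    · rw [h]
    · rw [h]; norm_num
  have h3 : ∑ t ∈ T, A t v * (lam * s) = lam * T.card := by
    have : ∀ t ∈ T, A t v * (lam * s) = lam := fun t ht => by
      rw [hA.symm.apply, (hT t ht).1]; linear_combination lam * hs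
    rw [Finset.sum_congr rfl this]; simp [mul_comm]
  have key := hq (Pi.single v (lam * s) + indVec T)
  simp only [Matrix.mulVec_add, dotProduct_add, add_dotProduct, hcol, hdot, single_dotProduct, hm,
    hA.diag, h1, h3, Pi.single_eq_same] at key
  have h4 : indVec T v = 0 := by simp [indVec, hvT]
  have h5 : ∑ t ∈ T, (Pi.single v (lam * s) : V → ℝ) t = 0 :=
    Finset.sum_eq_zero fun t ht => Pi.single_eq_of_ne (by rintro rfl; exact hvT ht) _
  have h6 : ∑ t ∈ T, indVec T t = T.card := by
    rw [Finset.sum_congr rfl fun t ht => show indVec T t = 1 by simp [indVec, ht]]; simp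
  simp only [h4, h5, h6] at key
  have h7 : lam * (T.card : ℝ) ≤ lam * lam ^ 2 := by
    nlinarith
  have h8 : (T.card : ℝ) < 5 := by
    have := le_of_mul_le_mul_left h7 h0
    linarith
  have h9 : T.card < 5 := by exact_mod_cast h8
  omega

/-- The vertices joined to `v`. -/
noncomputable def nbrs (A : Matrix V V ℝ) (v : V) : Finset V :=
  Finset.univ.filter fun u => A v u ≠ 0

theorem IsProper.card_nbrs_le {A : Matrix V V ℝ} (hA : IsSigned A) {p : ℕ} {c : V → Fin p}
    (hc : IsProper A c) {lam : ℝ} (h0 : 0 < lam) (h5 : lam ^ 2 < 5)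
    (hq : ∀ x : V → ℝ, x ⬝ᵥ A.mulVec x ≤ lam * (x ⬝ᵥ x)) (v : V) : (nbrs A v).card ≤ 8 * p := by
  have := Finset.card_le_mul_card_image_of_maps_to (s := nbrs A v)
    (f := fun t => (decide (A v t = 1), c t)) (t := (Finset.univ : Finset (Bool × Fin p)))
    (fun _ _ => Finset.mem_univ _) 4 (by
      rintro ⟨d, k⟩ -
      cases d
      · refine hc.card_le hA h0 h5 hq v (-1) (by norm_num) _ k fun t ht => ?_
        simp only [nbrs, Finset.mem_filter, Finset.mem_univ, true_and, Prod.mk.injEq,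
          decide_eq_false_iff_not] at ht
        refine ⟨?_, ht.2.2⟩
        have := hA.entries v t
        tauto
      · refine hc.card_le hA h0 h5 hq v 1 (by norm_num) _ k fun t ht => ?_
        simp only [nbrs, Finset.mem_filter, Finset.mem_univ, true_and, Prod.mk.injEq,
          decide_eq_true_eq] at ht
        exact ht.2)
  refine this.trans (le_of_eq ?_)
  simp
  ring

/-- The underlying simple graph. -/
def supportGraph {V : Type} (A : Matrix V V ℝ) (hA : IsSigned A) : SimpleGraph V where
  Adj u v := A u v ≠ 0
  symm := ⟨fun u v h => by rwa [hA.symm.apply]⟩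
  loopless := ⟨fun u h => h (hA.diag u)⟩

theorem IsConn.connected {A : Matrix V V ℝ} (hA : IsSigned A) (hc : IsConn A) [Nonempty V] :
    (supportGraph A hA).Connected := by
  refine (SimpleGraph.connected_iff _).2 ⟨fun u v => ?_, inferInstance⟩
  by_contra hcon
  obtain ⟨x, hx, y, hy, hxy⟩ := hc {x | (supportGraph A hA).Reachable u x} ⟨u, .refl u⟩ ⟨v, hcon⟩
  have hadj : (supportGraph A hA).Adj x y := hxy
  exact hy (SimpleGraph.Reachable.trans hx hadj.reachable)

theorem exists_path {A : Matrix V V ℝ} (hA : IsSigned A) (hc : IsConn A) {d L : ℕ}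
    (hd : ∀ v, (nbrs A v).card ≤ d) (hV : (d + 1) ^ L < Fintype.card V) :
    ∃ f : ℕ → V, (∀ i ≤ L, ∀ j ≤ L, f i = f j → i = j) ∧ (∀ i < L, A (f i) (f (i + 1)) ≠ 0) ∧
      ∀ i ≤ L, ∀ j ≤ L, i + 1 < j → A (f i) (f j) = 0 := by
  have hne : Nonempty V := Fintype.card_pos_iff.1 (by omega)
  have hG := hc.connected hA
  set G := supportGraph A hA with hGdef
  obtain ⟨o⟩ := hne
  set l : V → ℕ := G.dist o with hl
  have hstep : ∀ x y, A x y ≠ 0 → l y ≤ l x + 1 := by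
    intro x y hxy
    have h1 : G.Adj x y := hxy
    have h2 := hG.dist_triangle (u := o) (v := x) (w := y)
    rw [SimpleGraph.dist_eq_one_iff_adj.2 h1] at h2
    exact h2
  have hpred : ∀ y r, l y = r + 1 → ∃ x, A x y ≠ 0 ∧ l x = r := by
    intro y r hy
    obtain ⟨q, hq⟩ := hG.exists_walk_length_eq_dist y o
    rw [SimpleGraph.dist_comm] at hq
    cases q with
    | nil => simp [hl] at hy
    | cons hadj q =>
      rename_i x
      rw [SimpleGraph.Walk.length_cons] at hq
      have hq : q.length + 1 = l y := hq
      have h1 : A x y ≠ 0 := hadj.symm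
      refine ⟨x, h1, le_antisymm ?_ ?_⟩
      · have := SimpleGraph.dist_le q
        rw [SimpleGraph.dist_comm] at this
        have : l x ≤ q.length := this
        omega
      · have := hstep x y h1
        omega
  have hfar : ∃ v, L < l v := by
    by_contra! hcon
    have hball : ∀ r, (Finset.univ.filter fun v => l v ≤ r).card ≤ (d + 1) ^ r := by
      intro r
      induction r with
      | zero =>
        have : (Finset.univ.filter fun v => l v ≤ 0) ⊆ {o} := by
          intro v hv
          simp only [Finset.mem_filter, Finset.mem_univ, true_and, Nat.le_zero] at hv
          have := (hG.dist_eq_zero_iff).1 hv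
          simp [this]
        simpa using Finset.card_le_card this
      | succ r ih =>
        have : (Finset.univ.filter fun v => l v ≤ r + 1) ⊆
            (Finset.univ.filter fun v => l v ≤ r).biUnion fun x => insert x (nbrs A x) := by
          intro v hv
          simp only [Finset.mem_filter, Finset.mem_univ, true_and, Finset.mem_biUnion,
            Finset.mem_insert, nbrs] at hv ⊢
          obtain h | h := Nat.lt_or_ge r (l v)
          · obtain ⟨x, hx, hxr⟩ := hpred v r (by omega)
            exact ⟨x, hxr.le, Or.inr hx⟩
          · exact ⟨v, h, Or.inl rfl⟩
        calc _ ≤ _ := Finset.card_le_card this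
          _ ≤ _ := Finset.card_biUnion_le_card_mul _ _ (d + 1) fun x _ =>
            (Finset.card_insert_le _ _).trans (by have := hd x; omega)
          _ ≤ _ := by rw [pow_succ]; exact Nat.mul_le_mul_right _ ih
    have h1 := hball L
    rw [Finset.filter_true_of_mem fun v _ => hcon v, Finset.card_univ] at h1
    omega
  have hseq : ∀ r v, l v = r → ∃ f : ℕ → V, f r = v ∧ (∀ i ≤ r, l (f i) = i) ∧
      ∀ i < r, A (f i) (f (i + 1)) ≠ 0 := by
    intro r
    induction r with
    | zero =>
      intro v hv
      exact ⟨fun _ => v, rfl, fun i hi => by rw [hv]; omega, fun i hi => by omega⟩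
    | succ r ih =>
      intro v hv
      obtain ⟨x, hx, hxr⟩ := hpred v r hv
      obtain ⟨f, hfr, hf1, hf2⟩ := ih x hxr
      refine ⟨fun i => if i ≤ r then f i else v, by simp, fun i hi => ?_, fun i hi => ?_⟩
      · beta_reduce
        split_ifs with h
        · exact hf1 i h
        · rw [hv]; omega
      · obtain h | rfl : i < r ∨ i = r := by omega
        · beta_reduce
          rw [if_pos (by omega), if_pos (by omega)]
          exact hf2 i h
        · simpa [hfr] using hx
  obtain ⟨v, hv⟩ := hfar
  obtain ⟨f, -, hf1, hf2⟩ := hseq (l v) v rfl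
  refine ⟨f, fun i hi j hj hij => ?_, fun i hi => hf2 i (by omega), fun i hi j hj hij => ?_⟩
  · rw [← hf1 i (by omega), ← hf1 j (by omega), hij]
  · by_contra hne
    have := hstep _ _ hne
    rw [hf1 i (by omega), hf1 j (by omega)] at this
    omega

theorem le_of_path {A : Matrix V V ℝ} (hA : IsSigned A) {lam : ℝ} {L : ℕ}
    (hq : ∀ x : V → ℝ, x ⬝ᵥ A.mulVec x ≤ lam * (x ⬝ᵥ x)) {f : ℕ → V}
    (hf1 : ∀ i ≤ L, ∀ j ≤ L, f i = f j → i = j) (hf2 : ∀ i < L, A (f i) (f (i + 1)) ≠ 0)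
    (hf3 : ∀ i ≤ L, ∀ j ≤ L, i + 1 < j → A (f i) (f j) = 0) : 2 * (L : ℝ) ≤ lam * (L + 1) := by
  have main : ∀ k ≤ L, ∃ z : V → ℝ, (∀ v, z v ≠ 0 → ∃ j ≤ k, v = f j) ∧ z (f k) ^ 2 = 1 ∧
      z ⬝ᵥ z = k + 1 ∧ z ⬝ᵥ A.mulVec z = 2 * k := by
    intro k
    induction k with
    | zero =>
      intro _
      refine ⟨Pi.single (f 0) 1, fun v hv => ⟨0, le_rfl, ?_⟩, by simp, by simp, ?_⟩
      · by_contra hne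
        exact hv (Pi.single_eq_of_ne hne _)
      · rw [Matrix.mulVec_single_one]
        simp [hA.diag]
    | succ k ih =>
      intro hk
      obtain ⟨z, hz1, hz2, hz3, hz4⟩ := ih (by omega)
      set s : ℝ := A (f (k + 1)) (f k) * z (f k) with hs
      have hs2 : s ^ 2 = 1 := by
        rw [hs, mul_pow, hz2, hA.symm.apply]
        have := hf2 k (by omega)
        obtain h | h | h := hA.entries (f k) (f (k + 1))
        · rw [h]; norm_num
        · exact (this h).elim
        · rw [h]; norm_num
      have hz0 : z (f (k + 1)) = 0 := by
        by_contra hne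
        obtain ⟨j, hj, hj'⟩ := hz1 _ hne
        have := hf1 _ (by omega) j (by omega) hj'
        omega
      have hAz : (A.mulVec z) (f (k + 1)) = s := by
        rw [hs]
        refine Finset.sum_eq_single (f k) (fun v _ hv => ?_) (by simp)
        by_cases hzv : z v = 0
        · simp [hzv]
        · obtain ⟨j, hj, rfl⟩ := hz1 v hzv
          have hjk : j ≠ k := fun h => hv (by rw [h])
          show A (f (k + 1)) (f j) * z (f j) = 0
          rw [hA.symm.apply, hf3 j (by omega) (k + 1) (by omega) (by omega), zero_mul]
      have hcol : (A.mulVec (Pi.single (f (k + 1)) s)) (f (k + 1)) = 0 := by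
        simp [Matrix.mulVec_single, hA.diag]
      have hzc : z ⬝ᵥ A.mulVec (Pi.single (f (k + 1)) s) = s * s := by
        rw [Matrix.dotProduct_mulVec, ← Matrix.mulVec_transpose, hA.symm.eq]
        simp [hAz]
      refine ⟨z + Pi.single (f (k + 1)) s, fun v hv => ?_, by simpa [hz0] using hs2, ?_, ?_⟩
      · by_cases hvf : v = f (k + 1)
        · exact ⟨k + 1, le_rfl, hvf⟩
        · simp only [Pi.add_apply, Pi.single_eq_of_ne hvf, add_zero] at hv
          obtain ⟨j, hj, hj'⟩ := hz1 v hv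
          exact ⟨j, by omega, hj'⟩
      · simp only [dotProduct_add, add_dotProduct, hz3, single_dotProduct, dotProduct_single, hz0,
          Pi.add_apply, Pi.single_eq_same]
        push_cast
        linarith
      · simp only [Matrix.mulVec_add, dotProduct_add, add_dotProduct, hz4, hzc, single_dotProduct,
          hAz, hcol]
        push_cast
        linarith
  obtain ⟨z, -, -, h3, h4⟩ := main L le_rfl
  have := hq z
  rw [h3, h4] at this
  exact this

theorem exists_isRep_of_path {V : Type} {A : Matrix V V ℝ} (hA : IsSigned A) {L : ℕ} {f : ℕ → V}
    (hf1 : ∀ i ≤ L, ∀ j ≤ L, f i = f j → i = j) (hf2 : ∀ i < L, A (f i) (f (i + 1)) ≠ 0)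
    (hf3 : ∀ i ≤ L, ∀ j ≤ L, i + 1 < j → A (f i) (f j) = 0) :
    ∃ (N E : Type) (_ : Fintype N) (_ : Fintype E) (h : E → V) (a b : E → N),
      IsRep A h a b ∧ Fintype.card N = L + 1 := by
  have main : ∀ k ≤ L, ∃ (N E : Type) (_ : Fintype N) (_ : Fintype E) (h : E → V) (a b : E → N),
      IsRep A h a b ∧ Fintype.card N = k + 1 ∧ (∀ e, ∃ j < k, h e = f j) ∧
      ∃ (i : N) (σ : ℤ), (σ = 1 ∨ σ = -1) ∧
        ∀ e, edgeVec (a e) (b e) i = if h e = f (k - 1) then (σ : ℝ) else 0 := by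
    intro k
    induction k with
    | zero =>
      intro _
      refine ⟨Unit, Empty, inferInstance, inferInstance, Empty.elim, Empty.elim, Empty.elim,
        ⟨fun e => e.elim, fun e => e.elim, fun _ => ⟨0, fun e => e.elim⟩, ?_, rfl⟩, rfl,
        fun e => e.elim, (), 1, by simp, fun e => e.elim⟩
      rintro U ⟨x, hx⟩ ⟨y, hy⟩
      exact (hy hx).elim
    | succ k ih =>
      intro hk
      obtain ⟨N, E, i1, i2, h, a, b, hr, hcard, hlt, i, σ, hσ, hi⟩ := ih (by omega)
      have hu : ∀ e, h e ≠ f k := by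
        intro e he
        obtain ⟨j, hj, hj'⟩ := hlt e
        have := hf1 j (by omega) k (by omega) (hj'.symm.trans he)
        omega
      obtain ⟨s, hs, hw⟩ : ∃ s : ℤ, (s = 1 ∨ s = -1) ∧ IsLift A h a b (f k) (sgl i s) := by
        have hform : ∀ (s : ℤ) e, (sgl i s (a e) : ℝ) - sgl i s (b e)
            = s * edgeVec (a e) (b e) i := by
          intro s e
          simp only [sgl, edgeVec, eq_comm (a := i)]
          push_cast
          split_ifs <;> simp
        obtain rfl | ⟨r, rfl⟩ : k = 0 ∨ ∃ r, k = r + 1 := by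
          cases k
          · exact Or.inl rfl
          · exact Or.inr ⟨_, rfl⟩
        · exact ⟨1, by simp, fun e => by obtain ⟨j, hj, -⟩ := hlt e; omega⟩
        · have hne := hf2 r (by omega)
          have hcase : ∀ e, h e ≠ f r → A (f (r + 1)) (h e) = 0 := by
            intro e he
            obtain ⟨j, hj, hj'⟩ := hlt e
            have hjr : j ≠ r := fun hjr => he (by rw [hj', hjr])
            rw [hj', hA.symm.apply]
            exact hf3 j (by omega) (r + 1) (by omega) (by omega)
          have hσ2 : (σ : ℝ) * σ = 1 := by obtain rfl | rfl := hσ <;> norm_num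
          obtain hA1 | hA1 | hA1 := hA.entries (f r) (f (r + 1))
          · refine ⟨σ, hσ, fun e => ?_⟩
            rw [hform, hi, Nat.add_sub_cancel]
            split_ifs with he
            · rw [he, hA.symm.apply, hA1, hσ2]; norm_num
            · rw [hcase e he]; simp
          · exact (hne hA1).elim
          · refine ⟨-σ, by obtain h | h := hσ <;> simp [h], fun e => ?_⟩
            rw [hform, hi, Nat.add_sub_cancel]
            split_ifs with he
            · rw [he, hA.symm.apply, hA1]; push_cast; linarith
            · rw [hcase e he]; simp
      obtain ⟨a', b', hr', x, y, hxy, rfl, rfl⟩ := hr.extend hA hu hs hw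
      refine ⟨Option N, Option E, inferInstance, inferInstance, _, _, _, hr',
        by rw [Fintype.card_option, hcard], ?_, none, if x = none then 1 else -1, ?_, ?_⟩
      · rintro (_ | e)
        · exact ⟨k, by omega, rfl⟩
        · obtain ⟨j, hj, hj'⟩ := hlt e
          exact ⟨j, by omega, hj'⟩
      · split_ifs <;> simp
      · rintro (_ | e)
        · obtain ⟨rfl, rfl⟩ | ⟨rfl, rfl⟩ := hxy <;> simp [edgeVec]
        · have : h e ≠ f k := hu e
          simp [edgeVec, this]
  obtain ⟨N, E, i1, i2, h, a, b, hr, hcard, -⟩ := main L le_rfl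
  exact ⟨N, E, i1, i2, h, a, b, hr, hcard⟩

end Path

section Charge

/-- The weight of a pair of roots with the same support. -/
noncomputable def pairWeight {V : Type} {p : ℕ} (c : V → Fin p) (y : ℝ) (u v : V) : ℝ :=
  if c u = c v then -1 / 2 else y

theorem local_charge_le {V N : Type} {p : ℕ} (I : Finset V) (c : V → Fin p) (s : V → ℝ)
    (e : V → N) {y C : ℝ} (hs : ∀ u ∈ I, s u = 1 ∨ s u = -1)
    (h1 : ∀ u ∈ I, ∀ v ∈ I, e u ≠ e v → s u = s v → c u ≠ c v)
    (h2 : ∀ u ∈ I, ∀ v ∈ I, e u ≠ e v → s u ≠ s v → c u = c v)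
    (h3 : ∀ u ∈ I, ∀ v ∈ I, ∀ x ∈ I, u ≠ v → u ≠ x → v ≠ x → e u = e v → e u ≠ e x)
    (hy0 : 0 ≤ y) (hy : y ≤ 1 / 2) (hC1 : 3 ≤ C) (hC2 : p * (1 + y) ≤ C)
    (hC3 : 4 * (1 - y) ≤ C) :
    ∑ u ∈ I, (1 + ∑ v ∈ I.filter (fun v => u ≠ v ∧ e u = e v), s u * s v * pairWeight c y u v)
      ≤ C := by
  set F : V → ℝ := fun u =>
    1 + ∑ v ∈ I.filter (fun v => u ≠ v ∧ e u = e v), s u * s v * pairWeight c y u v with hF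
  have hF1 : ∀ u ∈ I, ∀ v ∈ I, u ≠ v → e u = e v → F u = 1 + s u * s v * pairWeight c y u v := by
    intro u hu v hv huv he
    have : I.filter (fun v => u ≠ v ∧ e u = e v) = {v} := by
      ext x
      simp only [Finset.mem_filter, Finset.mem_singleton]
      constructor
      · rintro ⟨hx, hux, hex⟩
        by_contra hxv
        exact h3 u hu v hv x hx huv hux (Ne.symm hxv) he hex
      · rintro rfl
        exact ⟨hv, huv, he⟩
    simp only [hF, this, Finset.sum_singleton]
  have hF0 : ∀ u ∈ I, (∀ v ∈ I, u ≠ v → e u ≠ e v) → F u = 1 := by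
    intro u hu h
    have : I.filter (fun v => u ≠ v ∧ e u = e v) = ∅ := by
      rw [Finset.filter_eq_empty_iff]
      rintro v hv ⟨h', h''⟩
      exact h v hv h' h''
    simp only [hF, this, Finset.sum_empty, add_zero]
  have hss : ∀ u ∈ I, ∀ v ∈ I, s u = s v → s u * s v = 1 := by
    intro u hu v hv h
    obtain h' | h' := hs v hv <;> rw [h, h'] <;> norm_num
  have hsn : ∀ u ∈ I, ∀ v ∈ I, s u ≠ s v → s u * s v = -1 := by
    intro u hu v hv h
    obtain h' | h' := hs v hv <;> obtain h'' | h'' := hs u hu <;> rw [h', h''] at h ⊢ <;>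
      first | exact (h rfl).elim | norm_num
  by_cases hcase : ∃ u ∈ I, ∃ v ∈ I, u ≠ v ∧ e u = e v ∧ s u ≠ s v ∧ c u = c v
  · obtain ⟨u, hu, v, hv, huv, he, hsuv, hc⟩ := hcase
    have hI : I = {u, v} := by
      ext x
      simp only [Finset.mem_insert, Finset.mem_singleton]
      refine ⟨fun hx => ?_, fun h => by obtain rfl | rfl := h <;> assumption⟩
      by_contra! hne
      have hex : e u ≠ e x := h3 u hu v hv x hx huv hne.1.symm hne.2.symm he
      by_cases hsx : s u = s x
      · exact h1 u hu x hx hex hsx (hc.trans (h2 v hv x hx (he ▸ hex) (hsx ▸ hsuv.symm)))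
      · have hsvx : s v = s x := by
          obtain h' | h' := hs v hv <;> obtain h'' | h'' := hs u hu <;>
            obtain h | h := hs x hx <;> rw [h'] <;> rw [h'', h'] at hsuv <;>
            rw [h'', h] at hsx <;> first | exact (hsuv rfl).elim | exact (hsx rfl).elim | rw [h]
        exact h1 v hv x hx (he ▸ hex) hsvx (hc.symm.trans (h2 u hu x hx hex hsx))
    have hFu := hF1 u hu v hv huv he
    have hFv := hF1 v hv u hu huv.symm he.symm
    rw [hsn u hu v hv hsuv, pairWeight, if_pos hc] at hFu
    rw [hsn v hv u hu hsuv.symm, pairWeight, if_pos hc.symm] at hFv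
    have : ∑ u ∈ I, F u = F u + F v := by
      conv_lhs => rw [hI]
      exact Finset.sum_pair huv
    rw [this]
    linarith
  push Not at hcase
  by_cases hpure : ∀ u ∈ I, ∀ v ∈ I, s u = s v
  · have hcls : ∀ k : Fin p, ∑ u ∈ I.filter (fun u => c u = k), F u ≤ 1 + y := by
      intro k
      by_cases hex : ∃ u ∈ I, ∃ v ∈ I, u ≠ v ∧ c u = k ∧ c v = k
      · obtain ⟨u, hu, v, hv, huv, hcu, hcv⟩ := hex
        have hee : ∀ a ∈ I, ∀ b ∈ I, c a = k → c b = k → e a = e b := by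
          intro a ha b hb hca hcb
          by_contra hne
          exact h1 a ha b hb hne (hpure a ha b hb) (hca.trans hcb.symm)
        have hT : I.filter (fun u => c u = k) = {u, v} := by
          ext x
          simp only [Finset.mem_filter, Finset.mem_insert, Finset.mem_singleton]
          refine ⟨fun hx => ?_, fun h => by
            obtain rfl | rfl := h <;> exact ⟨by assumption, by assumption⟩⟩
          by_contra! hne
          exact h3 u hu v hv x hx.1 huv hne.1.symm hne.2.symm (hee u hu v hv hcu hcv)
            (hee u hu x hx.1 hcu hx.2)
        have hFu := hF1 u hu v hv huv (hee u hu v hv hcu hcv)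
        have hFv := hF1 v hv u hu huv.symm (hee v hv u hu hcv hcu)
        rw [hss u hu v hv (hpure u hu v hv), pairWeight, if_pos (hcu.trans hcv.symm)] at hFu
        rw [hss v hv u hu (hpure v hv u hu), pairWeight, if_pos (hcv.trans hcu.symm)] at hFv
        rw [hT, Finset.sum_pair huv]
        linarith
      · push Not at hex
        have hle : ∀ u ∈ I, c u = k → F u ≤ 1 + y := by
          intro u hu hcu
          by_cases hp : ∀ v ∈ I, u ≠ v → e u ≠ e v
          · rw [hF0 u hu hp]; linarith
          · push Not at hp
            obtain ⟨v, hv, huv, he⟩ := hp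
            have hcv : c u ≠ c v := fun h => hex u hu v hv huv hcu (h ▸ hcu)
            rw [hF1 u hu v hv huv he, hss u hu v hv (hpure u hu v hv), pairWeight, if_neg hcv]
            linarith
        obtain hT | ⟨u, hu⟩ := (I.filter fun u => c u = k).eq_empty_or_nonempty
        · rw [hT, Finset.sum_empty]; linarith
        · have huI := Finset.mem_filter.1 hu
          have hT : I.filter (fun u => c u = k) = {u} := by
            ext x
            simp only [Finset.mem_filter, Finset.mem_singleton]
            refine ⟨fun hx => ?_, fun h => h ▸ huI⟩
            by_contra hne
            exact hex u huI.1 x hx.1 (Ne.symm hne) huI.2 hx.2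
          rw [hT, Finset.sum_singleton]
          exact hle u huI.1 huI.2
    calc ∑ u ∈ I, F u = ∑ k : Fin p, ∑ u ∈ I.filter (fun u => c u = k), F u :=
          (Finset.sum_fiberwise I c F).symm
      _ ≤ ∑ k : Fin p, (1 + y) := Finset.sum_le_sum fun k _ => hcls k
      _ = p * (1 + y) := by simp; ring
      _ ≤ C := hC2
  · push Not at hpure
    obtain ⟨a, ha, b, hb, hab⟩ := hpure
    have hopp : ∀ u ∈ I, ∃ x ∈ I, s u ≠ s x := by
      intro u hu
      by_cases h : s u = s a
      · exact ⟨b, hb, h ▸ hab⟩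
      · exact ⟨a, ha, h⟩
    have htri : ∀ u ∈ I, ∀ v ∈ I, ∀ x ∈ I, e u ≠ e v → e u ≠ e x → e v ≠ e x → s u = s v := by
      intro u hu v hv x hx huv hux hvx
      by_contra hne
      have hc := h2 u hu v hv huv hne
      by_cases hsx : s u = s x
      · exact h1 u hu x hx hux hsx (hc.trans (h2 v hv x hx hvx (hsx ▸ Ne.symm hne)))
      · have hsvx : s v = s x := by
          obtain h' | h' := hs v hv <;> obtain h'' | h'' := hs u hu <;>
            obtain h | h := hs x hx <;> rw [h'] <;> rw [h'', h'] at hne <;>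
            rw [h'', h] at hsx <;> first | exact (hne rfl).elim | exact (hsx rfl).elim | rw [h]
        exact h1 v hv x hx hvx hsvx (hc.symm.trans (h2 u hu x hx hux hsx))
    have hJ : (I.image e).card ≤ 2 := by
      by_contra! hcon
      have key : ∃ x ∈ I, ∃ z ∈ I, e x ≠ e a ∧ e z ≠ e a ∧ e x ≠ e z ∧ (e a ≠ e b → e x = e b) := by
        by_cases heab : e a = e b
        · have : 1 < ((I.image e).erase (e a)).card := by
            rw [Finset.card_erase_of_mem (Finset.mem_image_of_mem e ha)]; omega
          obtain ⟨j, hj, l, hl, hjl⟩ := Finset.one_lt_card.1 this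
          simp only [Finset.mem_erase, Finset.mem_image] at hj hl
          obtain ⟨hja, x, hx, rfl⟩ := hj
          obtain ⟨hla, z, hz, rfl⟩ := hl
          exact ⟨x, hx, z, hz, hja, hla, hjl, fun h => (h heab).elim⟩
        · have : 0 < (((I.image e).erase (e a)).erase (e b)).card := by
            rw [Finset.card_erase_of_mem (by simp [Ne.symm heab]; exact ⟨b, hb, rfl⟩),
              Finset.card_erase_of_mem (Finset.mem_image_of_mem e ha)]
            omega
          obtain ⟨l, hl⟩ := Finset.card_pos.1 this
          simp only [Finset.mem_erase, Finset.mem_image] at hl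
          obtain ⟨hlb, hla, z, hz, rfl⟩ := hl
          exact ⟨b, hb, z, hz, Ne.symm heab, hla, Ne.symm hlb, fun _ => rfl⟩
      obtain ⟨x, hx, z, hz, hxa, hza, hxz, hxb⟩ := key
      by_cases heab : e a = e b
      · have i1 := htri a ha x hx z hz hxa.symm hza.symm hxz
        have i2 := htri b hb x hx z hz (heab ▸ hxa.symm) (heab ▸ hza.symm) hxz
        exact hab (i1.trans i2.symm)
      · have hxb' := hxb heab
        exact hab (htri a ha b hb z hz heab hza.symm (hxb' ▸ hxz))
    have hcls : ∀ j ∈ I.image e, ∑ u ∈ I.filter (fun u => e u = j), F u ≤ 2 * (1 - y) := by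
      intro j hj
      obtain ⟨u, hu, rfl⟩ := Finset.mem_image.1 hj
      by_cases hp : ∀ v ∈ I, u ≠ v → e u ≠ e v
      · have hT : I.filter (fun x => e x = e u) = {u} := by
          ext x
          simp only [Finset.mem_filter, Finset.mem_singleton]
          refine ⟨fun hx => ?_, fun h => by rw [h]; exact ⟨hu, rfl⟩⟩
          by_contra hne
          exact hp x hx.1 (Ne.symm hne) hx.2.symm
        rw [hT, Finset.sum_singleton, hF0 u hu hp]
        linarith
      · push Not at hp
        obtain ⟨v, hv, huv, he⟩ := hp
        have hT : I.filter (fun x => e x = e u) = {u, v} := by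
          ext x
          simp only [Finset.mem_filter, Finset.mem_insert, Finset.mem_singleton]
          refine ⟨fun hx => ?_, fun h => by
            obtain h | h := h
            · rw [h]; exact ⟨hu, rfl⟩
            · rw [h]; exact ⟨hv, he.symm⟩⟩
          by_contra! hne
          exact h3 u hu v hv x hx.1 huv hne.1.symm hne.2.symm he hx.2.symm
        rw [hT, Finset.sum_pair huv, hF1 u hu v hv huv he, hF1 v hv u hu huv.symm he.symm]
        have hw : pairWeight c y v u = pairWeight c y u v := by
          simp only [pairWeight, eq_comm (a := c v)]
        rw [hw, mul_comm (s v) (s u)]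
        by_cases hsuv : s u = s v
        · have hc : c u = c v := by
            obtain ⟨x, hx, hux⟩ := hopp u hu
            have hxu : u ≠ x := fun h => hux (by rw [h])
            have hxv : v ≠ x := fun h => hux (by rw [hsuv, h])
            have hex := h3 u hu v hv x hx huv hxu hxv he
            exact (h2 u hu x hx hex hux).trans (h2 v hv x hx (he ▸ hex) (hsuv ▸ hux)).symm
          rw [hss u hu v hv hsuv, pairWeight, if_pos hc]
          linarith
        · rw [hsn u hu v hv hsuv, pairWeight, if_neg (hcase u hu v hv huv he hsuv)]
          linarith
    calc ∑ u ∈ I, F u = ∑ j ∈ I.image e, ∑ u ∈ I.filter (fun u => e u = j), F u :=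
          (Finset.sum_fiberwise_of_maps_to (fun u hu => Finset.mem_image_of_mem e hu) F).symm
      _ ≤ ∑ j ∈ I.image e, 2 * (1 - y) := Finset.sum_le_sum hcls
      _ = (I.image e).card * (2 * (1 - y)) := by simp
      _ ≤ 2 * (2 * (1 - y)) := by
          have : ((I.image e).card : ℝ) ≤ 2 := by exact_mod_cast hJ
          exact mul_le_mul_of_nonneg_right this (by linarith)
      _ ≤ C := by linarith

end Charge

section Counting

/-- The multiplicity of `μ` as an eigenvalue of `A`. -/
noncomputable def mult {V : Type} [Fintype V] (A : Matrix V V ℝ) (μ : ℝ) : ℕ :=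
  Module.finrank ℝ (Module.End.eigenspace (Matrix.mulVecLin A) μ)

theorem mem_eigenspace_mulVecLin {V : Type} [Fintype V] {A : Matrix V V ℝ} {μ : ℝ} {x : V → ℝ} :
    x ∈ Module.End.eigenspace (Matrix.mulVecLin A) μ ↔ A.mulVec x = μ • x := by
  rw [Module.End.mem_eigenspace_iff, Matrix.mulVecLin_apply]

theorem IsRoot.exists_other {N : Type} {w : N → ℤ} (hw : IsRoot w) {i : N} (hi : w i ≠ 0) :
    ∃ j, i ≠ j ∧ (w i = 1 ∨ w i = -1) ∧ (w j = 1 ∨ w j = -1) ∧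
      ∀ k, k ≠ i → k ≠ j → w k = 0 := by
  obtain ⟨a, b, s, s', hab, hs, hs', rfl⟩ := hw
  simp only [Pi.add_apply, sgl] at hi ⊢
  by_cases hia : i = a
  · subst hia
    refine ⟨b, hab, ?_, ?_, fun k h1 h2 => ?_⟩
    · simpa [hab] using hs
    · simpa [hab.symm] using hs'
    · simp [h1, h2]
  · have hib : i = b := by
      by_contra h
      simp [hia, h] at hi
    subst hib
    refine ⟨a, hia, ?_, ?_, fun k h1 h2 => ?_⟩
    · simpa [hia] using hs'
    · simpa [hab] using hs
    · simp [h1, h2]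

theorem castVec_dotProduct_of_support {N : Type} [Fintype N] {w v : N → ℤ} {i j : N} (hij : i ≠ j)
    (h : ∀ k, k ≠ i → k ≠ j → w k = 0) :
    castVec w ⬝ᵥ castVec v = (w i : ℝ) * v i + w j * v j := by
  rw [dotProduct, ← Finset.sum_subset (Finset.subset_univ {i, j}), Finset.sum_pair hij]
  · rfl
  · intro k _ hk
    simp only [Finset.mem_insert, Finset.mem_singleton, not_or] at hk
    simp [castVec, h k hk.1 hk.2]

variable {V N E : Type} [Fintype V] [Fintype N] [Fintype E] {A : Matrix V V ℝ}
  {h : E → V} {a b : E → N} {w : V → N → ℤ}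

theorem IsRootSystem.dotProduct_eq_zero (hs : IsRootSystem A h a b w) (hA : IsSigned A) {u v : V}
    (huv : u ≠ v) (hP : ∀ k, w u k ≠ 0 ↔ w v k ≠ 0) : castVec (w u) ⬝ᵥ castVec (w v) = 0 := by
  have hg := hs.gram u v huv
  obtain ⟨i, hi⟩ : ∃ i, w u i ≠ 0 := by
    by_contra! hne
    have := (hs.root u).dotProduct_self
    simp [castVec, dotProduct, hne] at this
  obtain ⟨j, hij, h1, h2, h3⟩ := (hs.root u).exists_other hi
  obtain ⟨j', hij', h1', h2', h3'⟩ := (hs.root v).exists_other ((hP i).1 hi)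
  have hjj : j = j' := by
    by_contra hne
    exact (hP j).1 (by obtain h | h := h2 <;> rw [h] <;> norm_num) (h3' j hij.symm hne)
  subst hjj
  rw [castVec_dotProduct_of_support hij h3] at hg ⊢
  obtain h | h | h := hA.entries u v <;> rw [h] at hg <;>
  obtain h1 | h1 := h1 <;> obtain h2 | h2 := h2 <;> obtain h1' | h1' := h1' <;>
    obtain h2' | h2' := h2' <;> rw [h1, h2, h1', h2'] at hg ⊢ <;>
    first | (exfalso; norm_num at hg; done) | norm_num

theorem IsRootSystem.two_mul_card_le (hs : IsRootSystem A h a b w) (hA : IsSigned A) {p : ℕ}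
    {c : V → Fin p} (hc : IsProper A c) {y C : ℝ} (hy0 : 0 ≤ y) (hy : y ≤ 1 / 2) (hC1 : 3 ≤ C)
    (hC2 : p * (1 + y) ≤ C) (hC3 : 4 * (1 - y) ≤ C) :
    2 * (Fintype.card V : ℝ) ≤ C * Fintype.card N := by
  set P : V → V → Prop := fun u v => u ≠ v ∧ ∀ k, w u k ≠ 0 ↔ w v k ≠ 0 with hP
  set G : N → V → ℝ := fun i u => (w u i : ℝ) * w u i +
    ∑ v, if P u v then (w u i : ℝ) * w v i * pairWeight c y u v else 0 with hG
  have hsum : ∑ i, ∑ u, G i u = 2 * Fintype.card V := by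
    rw [Finset.sum_comm]
    have : ∀ u, ∑ i, G i u = 2 := by
      intro u
      simp only [hG, Finset.sum_add_distrib]
      rw [Finset.sum_comm]
      have h1 : ∑ i, (w u i : ℝ) * w u i = 2 := (hs.root u).dotProduct_self
      rw [h1, Finset.sum_eq_zero, add_zero]
      intro v _
      by_cases hp : P u v
      · simp only [if_pos hp, ← Finset.sum_mul]
        have h2 : ∑ i, (w u i : ℝ) * w v i = 0 := hs.dotProduct_eq_zero hA hp.1 hp.2
        rw [h2, zero_mul]
      · simp [if_neg hp]
    simp [this, mul_comm]
  have hloc : ∀ i, ∑ u, G i u ≤ C := by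
    intro i
    set I : Finset V := Finset.univ.filter fun u => w u i ≠ 0 with hI
    have hmem : ∀ u, u ∈ I ↔ w u i ≠ 0 := fun u => by simp [hI]
    have hoth : ∀ u, ∃ j, u ∈ I → i ≠ j ∧ (w u i = 1 ∨ w u i = -1) ∧ (w u j = 1 ∨ w u j = -1) ∧
        ∀ k, k ≠ i → k ≠ j → w u k = 0 := by
      intro u
      by_cases hu : u ∈ I
      · obtain ⟨j, hj⟩ := (hs.root u).exists_other ((hmem u).1 hu)
        exact ⟨j, fun _ => hj⟩
      · exact ⟨i, fun h => (hu h).elim⟩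
    choose e he using hoth
    have hne : ∀ u ∈ I, w u (e u) ≠ 0 := by
      intro u hu
      obtain h | h := (he u hu).2.2.1 <;> rw [h] <;> norm_num
    have hdot : ∀ u ∈ I, ∀ v, castVec (w u) ⬝ᵥ castVec (w v) =
        (w u i : ℝ) * w v i + w u (e u) * w v (e u) := fun u hu v =>
      castVec_dotProduct_of_support (he u hu).1 (he u hu).2.2.2
    have hPiff : ∀ u ∈ I, ∀ v, P u v ↔ v ∈ I ∧ u ≠ v ∧ e u = e v := by
      intro u hu v
      constructor
      · rintro ⟨huv, hk⟩
        have hv : v ∈ I := (hmem v).2 ((hk i).1 ((hmem u).1 hu))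
        refine ⟨hv, huv, ?_⟩
        by_contra hne'
        exact (hk (e u)).1 (hne u hu) ((he v hv).2.2.2 _ (he u hu).1.symm hne')
      · rintro ⟨hv, huv, heq⟩
        refine ⟨huv, fun k => ?_⟩
        by_cases hk : k = i
        · subst hk
          exact iff_of_true ((hmem u).1 hu) ((hmem v).1 hv)
        by_cases hk' : k = e u
        · subst hk'
          exact iff_of_true (hne u hu) (heq ▸ hne v hv)
        · exact iff_of_false (not_not.2 ((he u hu).2.2.2 k hk hk'))
            (not_not.2 ((he v hv).2.2.2 k hk (heq ▸ hk')))
    have hA1 : ∀ u ∈ I, ∀ v ∈ I, e u ≠ e v → A u v = -((w u i : ℝ) * w v i) := by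
      intro u hu v hv hev
      rw [hs.gram u v (by rintro rfl; exact hev rfl), hdot u hu v,
        (he v hv).2.2.2 (e u) (he u hu).1.symm hev]
      simp
    have hpm : ∀ u ∈ I, (w u i : ℝ) = 1 ∨ (w u i : ℝ) = -1 := by
      intro u hu
      obtain h | h := (he u hu).2.1 <;> rw [h] <;> norm_num
    have hpm' : ∀ u ∈ I, (w u (e u) : ℝ) = 1 ∨ (w u (e u) : ℝ) = -1 := by
      intro u hu
      obtain h | h := (he u hu).2.2.1 <;> rw [h] <;> norm_num
    have key := local_charge_le I c (fun u => (w u i : ℝ)) e hpm ?_ ?_ ?_ hy0 hy hC1 hC2 hC3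
    · refine le_of_eq_of_le ?_ key
      rw [← Finset.sum_subset (Finset.subset_univ I)]
      · refine Finset.sum_congr rfl fun u hu => ?_
        simp only [hG]
        congr 1
        · obtain h | h := hpm u hu <;> rw [h] <;> norm_num
        · rw [← Finset.sum_filter]
          refine Finset.sum_congr ?_ fun _ _ => rfl
          ext v
          simp [hPiff u hu v]
      · intro u _ hu
        have : w u i = 0 := by simpa [hmem] using hu
        simp [hG, this]
    · intro u hu v hv hev hsuv
      refine (hc u v).2 ?_
      rw [hA1 u hu v hv hev]
      obtain h | h := hpm v hv <;> rw [hsuv, h] <;> norm_num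
    · intro u hu v hv hev hsuv
      refine (hc u v).1 ?_
      rw [hA1 u hu v hv hev]
      obtain h | h := hpm v hv <;> obtain h' | h' := hpm u hu <;> rw [h, h'] at hsuv ⊢ <;>
        first | exact (hsuv rfl).elim | norm_num
    · intro u hu v hv x hx huv hux hvx heuv heux
      have d1 := hs.dotProduct_eq_zero hA huv ((hPiff u hu v).2 ⟨hv, huv, heuv⟩).2
      have d2 := hs.dotProduct_eq_zero hA hux ((hPiff u hu x).2 ⟨hx, hux, heux⟩).2
      have d3 := hs.dotProduct_eq_zero hA hvx
        ((hPiff v hv x).2 ⟨hx, hvx, heuv.symm.trans heux⟩).2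
      have q1 := hpm' u hu
      have q2 := hpm' v hv
      have q3 := hpm' x hx
      rw [hdot u hu] at d1 d2
      rw [hdot v hv] at d3
      rw [← heuv] at d3 q2
      rw [← heux] at q3
      obtain h1 | h1 := hpm u hu <;> obtain h2 | h2 := hpm v hv <;>
        obtain h3 | h3 := hpm x hx <;> obtain h4 | h4 := q1 <;> obtain h5 | h5 := q2 <;>
        obtain h6 | h6 := q3 <;> rw [h1, h2, h4, h5] at d1 <;> rw [h1, h3, h4, h6] at d2 <;>
        rw [h2, h3, h5, h6] at d3 <;>
        first | (norm_num at d1; done) | (norm_num at d2; done) | norm_num at d3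
  rw [← hsum]
  calc ∑ i, ∑ u, G i u ≤ ∑ _i : N, C := Finset.sum_le_sum fun i _ => hloc i
    _ = C * Fintype.card N := by simp [mul_comm]

theorem IsRootSystem.dotProduct_mulVec (hs : IsRootSystem A h a b w) (hA : IsSigned A)
    (x : V → ℝ) : x ⬝ᵥ A.mulVec x =
      2 * (x ⬝ᵥ x) - (∑ u, x u • castVec (w u)) ⬝ᵥ (∑ u, x u • castVec (w u)) := by
  have hAuv : ∀ u v, A u v =
      (if u = v then 2 else 0) - castVec (w u) ⬝ᵥ castVec (w v) := by
    intro u v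
    by_cases huv : u = v
    · subst huv
      rw [hA.diag, if_pos rfl, (hs.root u).dotProduct_self, sub_self]
    · rw [hs.gram u v huv, if_neg huv, zero_sub]
  rw [sum_dotProduct]
  simp only [dotProduct_sum, smul_dotProduct, dotProduct_smul, smul_eq_mul]
  simp only [dotProduct, Matrix.mulVec]
  simp only [Finset.mul_sum, ← Finset.sum_sub_distrib]
  refine Finset.sum_congr rfl fun u _ => ?_
  have : 2 * (x u * x u) = ∑ v, x u * ((if u = v then 2 else 0) * x v) := by
    simp; ring
  rw [this, ← Finset.sum_sub_distrib]
  refine Finset.sum_congr rfl fun v _ => ?_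
  rw [hAuv u v]
  simp only [dotProduct, Finset.mul_sum, sub_mul, mul_sub, Finset.sum_mul]
  congr 1
  refine Finset.sum_congr rfl fun k _ => ?_
  ring

theorem IsRootSystem.dotProduct_mulVec_le (hs : IsRootSystem A h a b w) (hA : IsSigned A)
    (x : V → ℝ) : x ⬝ᵥ A.mulVec x ≤ 2 * (x ⬝ᵥ x) := by
  rw [hs.dotProduct_mulVec hA]
  have : 0 ≤ (∑ u, x u • castVec (w u)) ⬝ᵥ (∑ u, x u • castVec (w u)) :=
    Finset.sum_nonneg fun i _ => mul_self_nonneg _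
  linarith

theorem IsRootSystem.mult_add_le (hs : IsRootSystem A h a b w) (hA : IsSigned A) :
    mult A 2 + Fintype.card N ≤ Fintype.card V + 1 := by
  set R : Set V := Set.range h with hR
  let f : (V → ℝ) →ₗ[ℝ] ({u // u ∉ R} → ℝ) := LinearMap.funLeft ℝ ℝ Subtype.val
  let g := f.domRestrict (Module.End.eigenspace (Matrix.mulVecLin A) 2)
  have hinj : Function.Injective g := by
    rw [← LinearMap.ker_eq_bot, LinearMap.ker_eq_bot']
    rintro ⟨x, hx⟩ hgx
    rw [mem_eigenspace_mulVecLin] at hx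
    have hx0 : ∀ u, u ∉ R → x u = 0 := fun u hu => congrFun hgx ⟨u, hu⟩
    have hq := hs.dotProduct_mulVec hA x
    rw [hx, dotProduct_smul, smul_eq_mul] at hq
    have hz : (∑ u, x u • castVec (w u)) = 0 := by
      rw [← dotProduct_self_eq_zero]
      linarith
    have hzero : x = 0 := by
      funext u
      by_cases hu : u ∈ R
      · obtain ⟨e₀, rfl⟩ := hu
        obtain ⟨W, hW⟩ := hs.rep.lift (Pi.single e₀ 1)
        have h1 := congrArg (fun z => z ⬝ᵥ castVec W) hz
        simp only [sum_dotProduct, smul_dotProduct, zero_dotProduct, smul_eq_mul] at h1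
        have h2 : ∀ u, x u * (castVec (w u) ⬝ᵥ castVec W) =
            if u = h e₀ then x (h e₀) else 0 := by
          intro u
          by_cases hu : u ∈ R
          · obtain ⟨e, rfl⟩ := hu
            rw [hs.tree, edgeVec_dotProduct]
            have h3 : castVec W (a e) - castVec W (b e) = ((Pi.single e₀ 1 : E → ℤ) e : ℝ) := by
              rw [hW e]; simp [castVec]
            rw [h3]
            by_cases hee : e = e₀
            · subst hee; simp
            · have : h e ≠ h e₀ := fun h => hee (hs.rep.inj h)
              simp [hee, this]
          · have : u ≠ h e₀ := by rintro rfl; exact hu ⟨e₀, rfl⟩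
            simp [hx0 u hu, this]
        simpa [h2] using h1
      · exact hx0 u hu
    exact Subtype.ext hzero
  have h1 := LinearMap.finrank_le_finrank_of_injective hinj
  rw [Module.finrank_fintype_fun_eq_card] at h1
  have h2 : Fintype.card {u // u ∉ R} + Fintype.card E = Fintype.card V := by
    have h3 : Fintype.card {u // u ∈ R} = Fintype.card E := by
      rw [← Set.card_range_of_injective hs.rep.inj]
    have h4 := Fintype.card_subtype_compl (fun u => u ∈ R)
    have h5 := Fintype.card_subtype_le (fun u => u ∈ R)
    omega
  have h3 := hs.rep.card
  unfold mult
  omega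

/-- Large root systems of properly colored signed graphs do no better than the line graph of
`K_{p,p}`. -/
theorem IsRootSystem.sq_mul_mult_le (hs : IsRootSystem A h a b w) (hA : IsSigned A) {p : ℕ}
    (hp : 3 ≤ p) {c : V → Fin p} (hc : IsProper A c) (hN : 36 ≤ Fintype.card N)
    (hNp : 2 * p ≤ Fintype.card N) :
    p ^ 2 * mult A 2 ≤ (p - 1) ^ 2 * Fintype.card V := by
  have h1 := hs.mult_add_le hA
  obtain ⟨q, rfl⟩ : ∃ q, p = q + 1 := ⟨p - 1, by omega⟩
  rw [Nat.add_sub_cancel]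
  generalize mult A 2 = m at *
  generalize hn : Fintype.card N = n at *
  obtain hp4 | hp3 : 4 ≤ q + 1 ∨ q + 1 = 3 := by omega
  · have h4 : (4 : ℝ) ≤ (q + 1 : ℕ) := by exact_mod_cast hp4
    have h2 := hs.two_mul_card_le hA hc (y := 0) (C := (q + 1 : ℕ)) le_rfl (by norm_num)
      (by linarith) (by simp) (by simpa using h4)
    rw [hn] at h2
    have i1 : (m : ℝ) + n ≤ Fintype.card V + 1 := by exact_mod_cast h1
    have i3 : 2 * ((q + 1 : ℕ) : ℝ) ≤ n := by exact_mod_cast hNp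
    have i4 : ((q + 1 : ℕ) : ℝ) ^ 2 * m ≤ (q : ℝ) ^ 2 * Fintype.card V := by
      push_cast at *
      have j1 := mul_le_mul_of_nonneg_left i1 (sq_nonneg ((q : ℝ) + 1))
      have j2 := mul_le_mul_of_nonneg_left h2 (by positivity : (0 : ℝ) ≤ 2 * q + 1)
      have j3 := mul_le_mul_of_nonneg_left i3 (by positivity : (0 : ℝ) ≤ (q : ℝ) + 1)
      linarith
    exact_mod_cast i4
  · have h2 := hs.two_mul_card_le hA hc (y := 1 / 8) (C := 7 / 2) (by norm_num) (by norm_num)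
      (by norm_num) (by rw [hp3]; norm_num) (by norm_num)
    rw [hn] at h2
    have i1 : (m : ℝ) + n ≤ Fintype.card V + 1 := by exact_mod_cast h1
    have i2 : (36 : ℝ) ≤ n := by exact_mod_cast hN
    have hq : q = 2 := by omega
    subst hq
    have i4 : (9 : ℝ) * m ≤ 4 * Fintype.card V := by linarith
    exact_mod_cast i4

end Counting

section Comparator

theorem isEigenvalue_of_mult_ne_zero {V : Type} [Fintype V] {A : Matrix V V ℝ} {μ : ℝ}
    (h : mult A μ ≠ 0) : IsEigenvalue A μ := by
  have h1 : Module.End.eigenspace (Matrix.mulVecLin A) μ ≠ ⊥ := by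
    intro hb
    exact h (by rw [mult, hb, finrank_bot])
  obtain ⟨v, hv, hv0⟩ := Submodule.exists_mem_ne_zero_of_ne_bot h1
  exact ⟨v, hv0, mem_eigenspace_mulVecLin.1 hv⟩

theorem finite_setOf_isEigenvalue {V : Type} [Fintype V] (A : Matrix V V ℝ) :
    {μ : ℝ | IsEigenvalue A μ}.Finite := by
  refine (Module.End.finite_hasEigenvalue (Matrix.mulVecLin A)).subset ?_
  rintro μ ⟨v, hv, h⟩
  exact Module.End.hasEigenvalue_of_hasEigenvector (x := v)
    (Module.End.hasEigenvector_iff.2 ⟨mem_eigenspace_mulVecLin.2 h, hv⟩)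

theorem IsEigenvalue.le {V : Type} [Fintype V] {A : Matrix V V ℝ} {lam μ : ℝ}
    (hq : ∀ x : V → ℝ, x ⬝ᵥ A.mulVec x ≤ lam * (x ⬝ᵥ x)) (h : IsEigenvalue A μ) : μ ≤ lam := by
  obtain ⟨v, hv, h⟩ := h
  have h1 := hq v
  rw [h, dotProduct_smul, smul_eq_mul] at h1
  have h2 : 0 < v ⬝ᵥ v := by
    obtain ⟨i, hi⟩ := Function.ne_iff.1 hv
    exact Finset.sum_pos' (fun i _ => mul_self_nonneg _)
      ⟨i, Finset.mem_univ i, mul_self_pos.2 hi⟩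
  exact le_of_mul_le_mul_right h1 h2

theorem maxEig_eq_iff {V : Type} [Fintype V] {A : Matrix V V ℝ} (hA : A.IsSymm) {lam : ℝ}
    (h0 : 0 < lam) : maxEig A = lam ↔
      IsEigenvalue A lam ∧ ∀ x : V → ℝ, x ⬝ᵥ A.mulVec x ≤ lam * (x ⬝ᵥ x) := by
  have hfin := finite_setOf_isEigenvalue A
  constructor
  · intro h
    have hne : {μ : ℝ | IsEigenvalue A μ}.Nonempty := by
      by_contra hne
      rw [Set.not_nonempty_iff_eq_empty] at hne
      rw [maxEig, hne, Real.sSup_empty] at h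
      exact h0.ne h
    refine ⟨h ▸ hne.csSup_mem hfin, fun x => ?_⟩
    have hB : (lam • (1 : Matrix V V ℝ) - A).IsHermitian := by
      rw [Matrix.IsHermitian, Matrix.conjTranspose_eq_transpose_of_trivial, Matrix.transpose_sub,
        hA, Matrix.transpose_smul, Matrix.transpose_one]
    have hpos : (lam • (1 : Matrix V V ℝ) - A).PosSemidef := by
      rw [hB.posSemidef_iff_eigenvalues_nonneg]
      intro i
      have hv := hB.mulVec_eigenvectorBasis i
      have hv0 : (hB.eigenvectorBasis i : V → ℝ) ≠ 0 := by
        intro hz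
        exact hB.eigenvectorBasis.toBasis.ne_zero i (by
          rw [OrthonormalBasis.coe_toBasis]
          ext k
          exact congrFun hz k)
      have hle : lam - hB.eigenvalues i ≤ lam := by
        conv_rhs => rw [← h]
        refine le_csSup hfin.bddAbove ⟨_, hv0, ?_⟩
        rw [Matrix.sub_mulVec, Matrix.smul_mulVec, Matrix.one_mulVec] at hv
        rw [sub_smul, ← hv]
        abel
      simpa using hle
    have h2 := hpos.dotProduct_mulVec_nonneg x
    rw [Matrix.sub_mulVec, Matrix.smul_mulVec, Matrix.one_mulVec, dotProduct_sub,
      dotProduct_smul, star_trivial, smul_eq_mul] at h2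
    linarith
  · rintro ⟨h1, h2⟩
    exact IsGreatest.csSup_eq ⟨h1, fun μ hμ => IsEigenvalue.le h2 hμ⟩

theorem mult_submatrix {V W : Type} [Fintype V] [Fintype W] (e : W ≃ V) (A : Matrix V V ℝ)
    (μ : ℝ) : mult (A.submatrix e e) μ = mult A μ := by
  have : Module.End.eigenspace (Matrix.mulVecLin (A.submatrix e e)) μ =
      (Module.End.eigenspace (Matrix.mulVecLin A) μ).map
        (LinearEquiv.funCongrLeft ℝ ℝ e : (V → ℝ) →ₗ[ℝ] W → ℝ) := by
    ext x
    rw [Submodule.mem_map_equiv, mem_eigenspace_mulVecLin, mem_eigenspace_mulVecLin,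
      Matrix.submatrix_mulVec_equiv]
    have : ((LinearEquiv.funCongrLeft ℝ ℝ e).symm x : V → ℝ) = x ∘ e.symm := rfl
    rw [this]
    constructor
    · intro h
      funext v
      simpa using congrFun h (e.symm v)
    · intro h
      funext v
      simpa using congrFun h (e v)
  rw [mult, this]
  exact LinearEquiv.finrank_map_eq (LinearEquiv.funCongrLeft ℝ ℝ e) _

theorem exists_signedGraph {V : Type} [Fintype V] {A : Matrix V V ℝ} (hA : IsSigned A) {p : ℕ}
    {c : V → Fin p} (hc : IsProper A c) {lam : ℝ} (h0 : 0 < lam)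
    (hq : ∀ x : V → ℝ, x ⬝ᵥ A.mulVec x ≤ lam * (x ⬝ᵥ x)) (hm : mult A lam ≠ 0) :
    ∃ G : SignedGraph (Fintype.card V), ChromLe G p ∧ maxEig G.mat = lam ∧
      eigMult G.mat lam = mult A lam := by
  set e := (Fintype.equivFin V).symm
  refine ⟨⟨A.submatrix e e, hA.symm.submatrix e, fun i => hA.diag _, fun i j => hA.entries _ _⟩,
    ⟨c ∘ e, fun i j => hc (e i) (e j)⟩, ?_, mult_submatrix e A lam⟩
  rw [maxEig_eq_iff (hA.symm.submatrix e) h0]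
  refine ⟨isEigenvalue_of_mult_ne_zero (by rwa [mult_submatrix]), fun x => ?_⟩
  have h1 := hq (x ∘ e.symm)
  rw [Matrix.submatrix_mulVec_equiv]
  have h2 : ∀ y z : Fin (Fintype.card V) → ℝ, (y ∘ e.symm) ⬝ᵥ (z ∘ e.symm) = y ⬝ᵥ z := by
    intro y z
    exact Equiv.sum_comp e.symm fun i => y i * z i
  rw [h2, ← h2] at h1
  rw [← h2]
  convert h1 using 2
  · ext v; simp
  · rw [h2]

/-- The line graph of `K_{p,p}`, with all edges negative. -/
def rookMatrix (p : ℕ) : Matrix (Fin p × Fin p) (Fin p × Fin p) ℝ := fun u v =>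
  (if u = v then 2 else 0) - (if u.1 = v.1 then 1 else 0) - if u.2 = v.2 then 1 else 0

theorem rookMatrix_cases {p : ℕ} (u v : Fin p × Fin p) : rookMatrix p u v = 0 ∨
    rookMatrix p u v = -1 ∧ (u.1 = v.1 ∧ u.2 ≠ v.2 ∨ u.1 ≠ v.1 ∧ u.2 = v.2) := by
  simp only [rookMatrix, Prod.ext_iff]
  by_cases h1 : u.1 = v.1 <;> by_cases h2 : u.2 = v.2 <;> simp [h1, h2]
  norm_num

theorem isSigned_rookMatrix (p : ℕ) : IsSigned (rookMatrix p) where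
  symm := by
    ext u v
    simp only [Matrix.transpose_apply, rookMatrix, eq_comm]
  diag u := by simp [rookMatrix]; norm_num
  entries u v := by
    obtain h | ⟨h, -⟩ := rookMatrix_cases u v <;> simp [h]

theorem isProper_rookMatrix (q : ℕ) : IsProper (rookMatrix (q + 1)) fun u => u.1 + u.2 := by
  intro u v
  obtain h | ⟨h, h'⟩ := rookMatrix_cases u v
  · simp [h]
  · rw [h]
    refine ⟨fun h => by norm_num at h, fun _ heq => ?_⟩
    obtain ⟨h1, h2⟩ | ⟨h1, h2⟩ := h'
    · exact h2 (by simpa [h1] using heq)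
    · exact h1 (by simpa [h2] using heq)

theorem rookMatrix_mulVec {p : ℕ} (x : Fin p × Fin p → ℝ) (u : Fin p × Fin p) :
    (rookMatrix p).mulVec x u = 2 * x u - ∑ j, x (u.1, j) - ∑ i, x (i, u.2) := by
  simp only [Matrix.mulVec, dotProduct, rookMatrix, sub_mul, ite_mul, one_mul, zero_mul,
    Finset.sum_sub_distrib]
  congr 1
  · congr 1
    · simp
    · rw [Fintype.sum_prod_type]
      simp [Finset.sum_comm]
  · rw [Fintype.sum_prod_type]
    simp

theorem rookMatrix_le {p : ℕ} (x : Fin p × Fin p → ℝ) :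
    x ⬝ᵥ (rookMatrix p).mulVec x ≤ 2 * (x ⬝ᵥ x) := by
  have h : x ⬝ᵥ (rookMatrix p).mulVec x =
      2 * (x ⬝ᵥ x) - ∑ i, (∑ j, x (i, j)) ^ 2 - ∑ j, (∑ i, x (i, j)) ^ 2 := by
    have h1 : ∑ i, (∑ j, x (i, j)) ^ 2 = ∑ u : Fin p × Fin p, x u * ∑ j, x (u.1, j) := by
      rw [Fintype.sum_prod_type]
      exact Finset.sum_congr rfl fun i _ => by
        simp only [← Finset.sum_mul, sq]
    have h2 : ∑ j, (∑ i, x (i, j)) ^ 2 = ∑ u : Fin p × Fin p, x u * ∑ i, x (i, u.2) := by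
      rw [Fintype.sum_prod_type_right]
      exact Finset.sum_congr rfl fun i _ => by
        simp only [← Finset.sum_mul, sq]
    rw [h1, h2, dotProduct, dotProduct, Finset.mul_sum, ← Finset.sum_sub_distrib,
      ← Finset.sum_sub_distrib]
    refine Finset.sum_congr rfl fun u _ => ?_
    rw [rookMatrix_mulVec]
    ring
  have h1 : 0 ≤ ∑ i, (∑ j, x (i, j)) ^ 2 := Finset.sum_nonneg fun _ _ => sq_nonneg _
  have h2 : 0 ≤ ∑ j, (∑ i, x (i, j)) ^ 2 := Finset.sum_nonneg fun _ _ => sq_nonneg _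
  linarith

theorem le_mult_rookMatrix (q : ℕ) : q ^ 2 ≤ mult (rookMatrix (q + 1)) 2 := by
  let R : (Fin (q + 1) × Fin (q + 1) → ℝ) →ₗ[ℝ] (Fin (q + 1) → ℝ) :=
    { toFun := fun x i => ∑ j, x (i, j)
      map_add' := fun x y => by ext i; simp [Finset.sum_add_distrib]
      map_smul' := fun r x => by ext i; simp [Finset.mul_sum] }
  let S : (Fin (q + 1) × Fin (q + 1) → ℝ) →ₗ[ℝ] (Fin q → ℝ) :=
    { toFun := fun x j => ∑ i, x (i, j.castSucc)
      map_add' := fun x y => by ext i; simp [Finset.sum_add_distrib]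
      map_smul' := fun r x => by ext i; simp [Finset.mul_sum] }
  have hker : LinearMap.ker (R.prod S) ≤
      Module.End.eigenspace (Matrix.mulVecLin (rookMatrix (q + 1))) 2 := by
    intro x hx
    replace hx : (R x, S x) = 0 := hx
    rw [Prod.mk_eq_zero] at hx
    have h1 : ∀ i, ∑ j, x (i, j) = 0 := fun i => congrFun hx.1 i
    have h2 : ∀ j : Fin q, ∑ i, x (i, j.castSucc) = 0 := fun j => congrFun hx.2 j
    have h3 : ∑ i, x (i, Fin.last q) = 0 := by
      have h4 : ∑ j, ∑ i, x (i, j) = 0 := by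
        rw [Finset.sum_comm]
        exact Finset.sum_eq_zero fun i _ => h1 i
      rw [Fin.sum_univ_castSucc] at h4
      simpa [h2] using h4
    rw [mem_eigenspace_mulVecLin]
    funext u
    rw [rookMatrix_mulVec, h1]
    have h5 : ∀ j, ∑ i, x (i, j) = 0 := fun j => Fin.lastCases h3 h2 j
    rw [h5]
    simp
  have h1 := Submodule.finrank_mono hker
  have h2 := LinearMap.finrank_range_add_finrank_ker (R.prod S)
  have h3 := Submodule.finrank_le (LinearMap.range (R.prod S))
  rw [Module.finrank_prod] at h3
  simp only [Module.finrank_fintype_fun_eq_card, Fintype.card_prod, Fintype.card_fin] at h2 h3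
  rw [mult]
  nlinarith

theorem exists_rook_signedGraph {p : ℕ} (hp : 3 ≤ p) :
    ∃ G : SignedGraph (p ^ 2), ChromLe G p ∧ maxEig G.mat = 2 ∧
      (p - 1) ^ 2 ≤ eigMult G.mat 2 := by
  obtain ⟨q, rfl⟩ : ∃ q, p = q + 1 := ⟨p - 1, by omega⟩
  have h := le_mult_rookMatrix q
  have hq : 0 < q ^ 2 := by
    have : 0 < q := by omega
    positivity
  obtain ⟨G, h1, h2, h3⟩ := exists_signedGraph (isSigned_rookMatrix (q + 1))
    (isProper_rookMatrix q) two_pos rookMatrix_le (by omega)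
  have hcard : Fintype.card (Fin (q + 1) × Fin (q + 1)) = (q + 1) ^ 2 := by
    simp [sq]
  rw [← hcard]
  exact ⟨G, h1, h2, by rw [h3]; simpa using h⟩

end Comparator

section Global

theorem exists_large_bound {βs lamStar lam : ℝ} (hβs : βs ^ 3 = βs + 1)
    (hstar : lamStar = Real.sqrt βs + (Real.sqrt βs)⁻¹) {p : ℕ} (hp : 3 ≤ p) (h0 : 0 < lam)
    (hlt : lam < lamStar) :
    ∃ M : ℕ, ∀ (V : Type) [Fintype V] (A : Matrix V V ℝ) (c : V → Fin p), IsSigned A →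
      IsProper A c → (∀ x : V → ℝ, x ⬝ᵥ A.mulVec x ≤ lam * (x ⬝ᵥ x)) → IsConn A →
      M < Fintype.card V →
      mult A lam = 0 ∨ lam = 2 ∧ p ^ 2 * mult A 2 ≤ (p - 1) ^ 2 * Fintype.card V := by
  obtain ⟨t, ht1, ht2, ht6, hlam⟩ := exists_cut_parameter hβs hstar hlt
  obtain ⟨C₁, C₂, C₃, n₀, hC, hB⟩ := exists_cutBounds ht1 ht2 ht6 rfl
  have ht0 : 0 < t := by linarith
  have ht : t * (1 / t) = 1 := by field_simp
  have hinv : 1 / t < 0.88 := by rw [div_lt_iff₀ ht0]; linarith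
  have hε : 0 < t + 1 / t - 2 := by nlinarith
  obtain ⟨L₀, hL₀⟩ : ∃ L₀ : ℕ, lam < 2 → ∀ L : ℕ, L₀ ≤ L → lam * (L + 1) < 2 * L := by
    obtain ⟨k, hk⟩ := exists_nat_gt (lam / (2 - lam))
    refine ⟨k, fun h2 L hL => ?_⟩
    have h3 : 0 < 2 - lam := by linarith
    rw [div_lt_iff₀ h3] at hk
    have h4 : (k : ℝ) ≤ L := by exact_mod_cast hL
    nlinarith
  refine ⟨(8 * p + 1) ^ (L₀ + n₀ + 36 + 2 * p), fun V _ A c hA hc hq hconn hV => ?_⟩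
  set L := L₀ + n₀ + 36 + 2 * p
  obtain ⟨f, hf1, hf2, hf3⟩ := exists_path hA hconn
    (hc.card_nbrs_le hA h0 (by nlinarith) hq) hV
  by_cases h2 : lam < 2
  · have h3 := le_of_path hA hq hf1 hf2 hf3
    have h4 := hL₀ h2 L (by omega)
    linarith
  · obtain ⟨N, E, _, _, h, a, b, hr, hN⟩ := exists_isRep_of_path hA hf1 hf2 hf3
    obtain ⟨N', E', _, _, h', a', b', w, hNN, hs⟩ := exists_isRootSystem hr hA hconn
      (μ := t + 1 / t) (ε := t + 1 / t - 2) (by ring) hε (fun x => (hq x).trans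
        (mul_le_mul_of_nonneg_right hlam.le (Finset.sum_nonneg fun i _ => mul_self_nonneg _)))
      hC hB (by omega) (by omega)
    by_cases h3 : lam = 2
    · exact Or.inr ⟨h3, hs.sq_mul_mult_le hA hp hc (by omega) (by omega)⟩
    · left
      by_contra hm
      have h4 := (isEigenvalue_of_mult_ne_zero hm).le (hs.dotProduct_mulVec_le hA)
      exact h3 (le_antisymm h4 (not_lt.1 h2))

theorem submatrix_le {V : Type} [Fintype V] {A : Matrix V V ℝ} {lam : ℝ}
    (hq : ∀ x : V → ℝ, x ⬝ᵥ A.mulVec x ≤ lam * (x ⬝ᵥ x)) (P : V → Prop) (y : {v // P v} → ℝ) :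
    y ⬝ᵥ (A.submatrix Subtype.val Subtype.val).mulVec y ≤ lam * (y ⬝ᵥ y) := by
  set x : V → ℝ := fun v => if h : P v then y ⟨v, h⟩ else 0 with hx
  have hxy : ∀ i : {v // P v}, x i = y i := fun i => by simp [hx, i.2]
  have hx0 : ∀ v, v ∉ Set.range (Subtype.val : {v // P v} → V) → x v = 0 := by
    intro v hv
    have : ¬ P v := by simpa using hv
    simp [hx, this]
  have hsum : ∀ g : V → ℝ, ∑ i : {v // P v}, y i * g i = ∑ v, x v * g v := fun g =>
    Fintype.sum_of_injective Subtype.val Subtype.val_injective _ _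
      (fun v hv => by rw [hx0 v hv, zero_mul]) fun i => by rw [hxy]
  have h1 : y ⬝ᵥ y = x ⬝ᵥ x := by
    rw [dotProduct, dotProduct, ← hsum]
    simp only [hxy]
  have h2 : y ⬝ᵥ (A.submatrix Subtype.val Subtype.val).mulVec y = x ⬝ᵥ A.mulVec x := by
    rw [dotProduct, dotProduct, ← hsum]
    refine Finset.sum_congr rfl fun i _ => ?_
    congr 1
    simp only [Matrix.mulVec, dotProduct, Matrix.submatrix_apply, mul_comm (A _ _)]
    exact hsum _
  rw [h1, h2]
  exact hq x

theorem submatrix_mulVec_of_cut {V : Type} [Fintype V] {A : Matrix V V ℝ} {P : V → Prop}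
    (hP : ∀ u v, P u → ¬ P v → A u v = 0) {μ : ℝ} {x : V → ℝ} (hx : A.mulVec x = μ • x) :
    (A.submatrix Subtype.val Subtype.val).mulVec (fun v : {v // P v} => x v) =
      μ • fun v : {v // P v} => x v := by
  funext u
  have h1 := congrFun hx u
  rw [Pi.smul_apply] at h1 ⊢
  rw [← h1]
  refine Fintype.sum_of_injective Subtype.val Subtype.val_injective _ _ (fun v hv => ?_)
    fun _ => rfl
  have : A u v = 0 := hP u v u.2 (by simpa using hv)
  simp only [this, zero_mul]

theorem mult_le_add_of_cut {V : Type} [Fintype V] {A : Matrix V V ℝ} {P Q : V → Prop}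
    (hQ : ∀ v, Q v ↔ ¬ P v) (hP : ∀ u v, P u → Q v → A u v = 0)
    (hP' : ∀ u v, Q u → P v → A u v = 0) (μ : ℝ) :
    mult A μ ≤ mult (A.submatrix (Subtype.val : {v // P v} → V) Subtype.val) μ +
      mult (A.submatrix (Subtype.val : {v // Q v} → V) Subtype.val) μ := by
  let f (R : V → Prop) : (V → ℝ) →ₗ[ℝ] ({v // R v} → ℝ) := LinearMap.funLeft ℝ ℝ Subtype.val
  let g₁ := (f P).restrict (p := Module.End.eigenspace (Matrix.mulVecLin A) μ)
    (q := Module.End.eigenspace (Matrix.mulVecLin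
      (A.submatrix (Subtype.val : {v // P v} → V) Subtype.val)) μ)
    (fun x hx => mem_eigenspace_mulVecLin.2
      (submatrix_mulVec_of_cut (fun u v hu hv => hP u v hu ((hQ v).2 hv))
        (mem_eigenspace_mulVecLin.1 hx)))
  let g₂ := (f Q).restrict (p := Module.End.eigenspace (Matrix.mulVecLin A) μ)
    (q := Module.End.eigenspace (Matrix.mulVecLin
      (A.submatrix (Subtype.val : {v // Q v} → V) Subtype.val)) μ)
    (fun x hx => mem_eigenspace_mulVecLin.2
      (submatrix_mulVec_of_cut (fun u v hu hv => hP' u v hu (not_not.1 fun h => hv ((hQ v).2 h)))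
        (mem_eigenspace_mulVecLin.1 hx)))
  have hinj : Function.Injective (g₁.prod g₂) := by
    rw [← LinearMap.ker_eq_bot, LinearMap.ker_eq_bot']
    rintro ⟨x, hx⟩ hgx
    replace hgx : (g₁ ⟨x, hx⟩, g₂ ⟨x, hx⟩) = 0 := hgx
    rw [Prod.mk_eq_zero] at hgx
    ext v
    by_cases hv : P v
    · exact congrFun (congrArg Subtype.val hgx.1) ⟨v, hv⟩
    · exact congrFun (congrArg Subtype.val hgx.2) ⟨v, (hQ v).2 hv⟩
  have := LinearMap.finrank_le_finrank_of_injective hinj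
  rwa [Module.finrank_prod] at this

theorem card_eq_add_of_compl {V : Type} [Fintype V] {P Q : V → Prop} (hQ : ∀ v, Q v ↔ ¬ P v) :
    Fintype.card V = Fintype.card {v // P v} + Fintype.card {v // Q v} := by
  obtain rfl : Q = fun v => ¬ P v := funext fun v => propext (hQ v)
  have h1 := Fintype.card_subtype_compl P
  have h2 := Fintype.card_subtype_le P
  convert (show Fintype.card V = Fintype.card {v // P v} + Fintype.card {v // ¬ P v} by omega)

theorem mul_mult_le {p : ℕ} (hp : 3 ≤ p) {lam : ℝ} (h0 : 0 < lam) {N M : ℕ} (hN : p ^ 2 ≤ N)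
    (hMN : M ≤ N)
    (hM : ∀ (V : Type) [Fintype V] (A : Matrix V V ℝ) (c : V → Fin p), IsSigned A →
      IsProper A c → (∀ x : V → ℝ, x ⬝ᵥ A.mulVec x ≤ lam * (x ⬝ᵥ x)) → IsConn A →
      M < Fintype.card V →
      mult A lam = 0 ∨ lam = 2 ∧ p ^ 2 * mult A 2 ≤ (p - 1) ^ 2 * Fintype.card V)
    {r : ℝ≥0∞} (hr : ∀ n ≤ N, ∀ G : SignedGraph n, ChromLe G p ∧ maxEig G.mat = lam →
      r ≤ (n : ℝ≥0∞) / (eigMult G.mat lam : ℝ≥0∞)) :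
    ∀ (k : ℕ) (V : Type) [Fintype V] (A : Matrix V V ℝ) (c : V → Fin p), Fintype.card V = k →
      IsSigned A → IsProper A c → (∀ x : V → ℝ, x ⬝ᵥ A.mulVec x ≤ lam * (x ⬝ᵥ x)) →
      r * mult A lam ≤ Fintype.card V := by
  intro k
  induction k using Nat.strong_induction_on with
  | _ k ih =>
  intro V _ A c hk hA hc hq
  by_cases hm : mult A lam = 0
  · simp [hm]
  by_cases hVN : Fintype.card V ≤ N
  · obtain ⟨G, h1, h2, h3⟩ := exists_signedGraph hA hc h0 hq hm
    rw [← h3]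
    exact ENNReal.mul_le_of_le_div (hr _ hVN G ⟨h1, h2⟩)
  by_cases hconn : IsConn A
  · obtain h | ⟨rfl, h⟩ := hM V A c hA hc hq hconn (by omega)
    · exact (hm h).elim
    obtain ⟨G, h1, h2, h3⟩ := exists_rook_signedGraph hp
    have h4 := ENNReal.mul_le_of_le_div (hr _ hN G ⟨h1, h2⟩)
    have h5 : r * ((p - 1) ^ 2 : ℕ) ≤ (p ^ 2 : ℕ) :=
      (mul_le_mul_right (by exact_mod_cast h3) r).trans h4
    have h6 : ((p ^ 2 : ℕ) : ℝ≥0∞) * mult A 2 ≤ ((p - 1) ^ 2 : ℕ) * Fintype.card V := by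
      exact_mod_cast h
    have hp0 : ((p ^ 2 : ℕ) : ℝ≥0∞) ≠ 0 := by
      rw [Nat.cast_ne_zero]
      positivity
    rw [← ENNReal.mul_le_mul_iff_right hp0 (ENNReal.natCast_ne_top _)]
    calc ((p ^ 2 : ℕ) : ℝ≥0∞) * (r * mult A 2) = r * ((p ^ 2 : ℕ) * mult A 2) := by ring
      _ ≤ r * (((p - 1) ^ 2 : ℕ) * Fintype.card V) := by gcongr
      _ = r * ((p - 1) ^ 2 : ℕ) * Fintype.card V := by ring
      _ ≤ (p ^ 2 : ℕ) * Fintype.card V := by gcongr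
  · unfold IsConn at hconn
    push Not at hconn
    obtain ⟨S, ⟨s, hs⟩, ⟨s', hs'⟩, hcut⟩ := hconn
    have hcut' : ∀ u v, u ∉ S → v ∈ S → A u v = 0 := fun u v hu hv => by
      rw [← hcut v hv u hu, hA.symm.apply]
    have h1 := mult_le_add_of_cut (P := fun v => v ∈ S) (Q := fun v => v ∉ S) (fun _ => Iff.rfl)
      (fun u v hu hv => hcut u hu v hv)
      hcut' lam
    have hsub : ∀ P : V → Prop, (∃ v, ¬ P v) →
        r * mult (A.submatrix (Subtype.val : {v // P v} → V) Subtype.val) lam ≤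
          Fintype.card {v // P v} := by
      rintro P ⟨v, hv⟩
      exact ih _ (hk ▸ Fintype.card_subtype_lt hv) _ _ (fun v => c v) rfl
        ⟨hA.symm.submatrix _, fun i => hA.diag _, fun i j => hA.entries _ _⟩
        (fun i j => hc _ _) (submatrix_le hq P)
    have h2 := hsub (fun v => v ∈ S) ⟨s', hs'⟩
    have h3 := hsub (fun v => v ∉ S) ⟨s, not_not.2 hs⟩
    have h4 := card_eq_add_of_compl (P := fun v => v ∈ S) (Q := fun v => v ∉ S) fun _ => Iff.rfl
    rw [h4, Nat.cast_add]
    refine le_trans ?_ (add_le_add h2 h3)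
    rw [← mul_add]
    gcongr
    exact_mod_cast h1

theorem eigMult_le {n : ℕ} (A : Matrix (Fin n) (Fin n) ℝ) (μ : ℝ) : eigMult A μ ≤ n := by
  have := Submodule.finrank_le (Module.End.eigenspace (Matrix.toLin' A) μ)
  rwa [Module.finrank_fintype_fun_eq_card, Fintype.card_fin] at this

end Global

/-- For `p ≥ 3` and `0 < λ < λ*`, the quantity `k_p(λ)` equals the corresponding minimum over
signed graphs with at most `N` vertices for some `N`; in particular if `k_p(λ) < ∞` then the
infimum defining it is attained. -/
theorem kp_achievable (βs lamStar : ℝ) (hβs : βs ^ 3 = βs + 1)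
    (hstar : lamStar = Real.sqrt βs + (Real.sqrt βs)⁻¹)
    (p : ℕ) (hp : 3 ≤ p) (lam : ℝ) (h0 : 0 < lam) (hlt : lam < lamStar) :
    ∃ N : ℕ,
      (kp p lam =
        ⨅ (n : ℕ) (_ : n ≤ N) (G : SignedGraph n)
          (_ : ChromLe G p ∧ maxEig G.mat = lam),
            (n : ℝ≥0∞) / (eigMult G.mat lam : ℝ≥0∞)) ∧
      (kp p lam ≠ ⊤ → ∃ (n : ℕ) (G : SignedGraph n),
        ChromLe G p ∧ maxEig G.mat = lam ∧
          kp p lam = (n : ℝ≥0∞) / (eigMult G.mat lam : ℝ≥0∞)) := by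
  obtain ⟨M, hM⟩ := exists_large_bound hβs hstar hp h0 hlt
  set N := max M (p ^ 2) with hN
  have hkp : kp p lam = ⨅ (n : ℕ) (_ : n ≤ N) (G : SignedGraph n)
      (_ : ChromLe G p ∧ maxEig G.mat = lam),
        (n : ℝ≥0∞) / (eigMult G.mat lam : ℝ≥0∞) := by
    refine le_antisymm (le_iInf fun n => le_iInf fun _ => iInf_le _ n) ?_
    refine le_iInf fun n => le_iInf fun G => le_iInf fun hG => ?_
    obtain ⟨⟨v, hv, -⟩, hq⟩ := (maxEig_eq_iff G.isSymm h0).1 hG.2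
    obtain ⟨i, -⟩ := Function.ne_iff.1 hv
    obtain ⟨c, hc⟩ := hG.1
    have hn : (n : ℝ≥0∞) ≠ 0 := Nat.cast_ne_zero.2 (by have := i.2; omega)
    rw [ENNReal.le_div_iff_mul_le (Or.inr hn) (Or.inl (ENNReal.natCast_ne_top _))]
    have := mul_mult_le hp h0 (le_max_right M (p ^ 2)) (le_max_left M (p ^ 2)) hM
      (fun n hn G hG => iInf_le_of_le n (iInf_le_of_le hn (iInf_le_of_le G (iInf_le _ hG))))
      n (Fin n) G.mat c (Fintype.card_fin n) ⟨G.isSymm, G.diag_zero, G.entries⟩ hc hq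
    rwa [Fintype.card_fin] at this
  refine ⟨N, hkp, fun htop => ?_⟩
  set T : Set ℝ≥0∞ := {q | ∃ (n : ℕ) (G : SignedGraph n), n ≤ N ∧
    (ChromLe G p ∧ maxEig G.mat = lam) ∧ q = (n : ℝ≥0∞) / (eigMult G.mat lam : ℝ≥0∞)} with hT
  have hfin : T.Finite := by
    refine ((Set.finite_Iic N).image2 (fun a b : ℕ => (a : ℝ≥0∞) / b) (Set.finite_Iic N)).subset ?_
    rintro q ⟨n, G, hn, -, rfl⟩
    exact ⟨n, hn, _, (eigMult_le _ _).trans hn, rfl⟩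
  have hne : T.Nonempty := by
    by_contra hne
    refine htop ?_
    rw [hkp]
    simp only [iInf_eq_top]
    exact fun n hn G hG => (hne ⟨_, n, G, hn, hG, rfl⟩).elim
  obtain ⟨n, G, hn, hG, hq⟩ := hne.csInf_mem hfin
  refine ⟨n, G, hG.1, hG.2, le_antisymm (iInf₂_le_of_le n G (iInf_le _ hG)) ?_⟩
  rw [← hq, hkp]
  exact le_iInf fun n => le_iInf fun hn => le_iInf fun G => le_iInf fun hG =>
    sInf_le ⟨n, G, hn, hG, rfl⟩
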